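/- arXiv:1508.00063 — 2 statements merged into one kernel-verified Lean document; each statement's English description precedes it below -/
import Mathlib

section
/- Let α ≥ 1 and let u₀ : [0,1] → ℝ be a continuous nonnegative function with ∫₀¹ u₀(x) dx ≥ 1. Then there exists a nonnegative classical solution u of the one-dimensional nonlocal Fisher–KPP problem with initial datum u₀, and this solution is unique: any two nonnegative classical solutions with initial datum u₀ coincide on [0,∞) × [0,1]. -/
open Set Real MeasureTheory intervalIntegral

/-- A (global) classical solution of the one-dimensional nonlocal Fisher–KPP problem
`∂ₜu = ∂ₓₓu + u^α (1 - ∫₀¹ u dy)` on `Ω = (0,1)`, with Neumann boundary conditions.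
`ut`, `ux`, `uxx` are the time derivative and the first and second spatial derivatives
of `u`; they exist on `(0,∞) × [0,1]` and are jointly continuous there, while `u`
itself is continuous on `[0,∞) × [0,1]`. -/
def IsKPPSolution (α : ℝ) (u ut ux uxx : ℝ → ℝ → ℝ) : Prop :=
  ContinuousOn (fun p : ℝ × ℝ => u p.1 p.2) (Ici 0 ×ˢ Icc 0 1) ∧
  ContinuousOn (fun p : ℝ × ℝ => ut p.1 p.2) (Ioi 0 ×ˢ Icc 0 1) ∧
  ContinuousOn (fun p : ℝ × ℝ => ux p.1 p.2) (Ioi 0 ×ˢ Icc 0 1) ∧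
  ContinuousOn (fun p : ℝ × ℝ => uxx p.1 p.2) (Ioi 0 ×ˢ Icc 0 1) ∧
  (∀ t ∈ Ioi (0:ℝ), ∀ x ∈ Icc (0:ℝ) 1, HasDerivAt (fun s => u s x) (ut t x) t) ∧
  (∀ t ∈ Ioi (0:ℝ), ∀ x ∈ Icc (0:ℝ) 1,
    HasDerivWithinAt (fun y => u t y) (ux t x) (Icc 0 1) x) ∧
  (∀ t ∈ Ioi (0:ℝ), ∀ x ∈ Icc (0:ℝ) 1,
    HasDerivWithinAt (fun y => ux t y) (uxx t x) (Icc 0 1) x) ∧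
  (∀ t ∈ Ioi (0:ℝ), ∀ x ∈ Icc (0:ℝ) 1,
    ut t x = uxx t x + u t x ^ α * (1 - ∫ y in (0:ℝ)..1, u t y)) ∧
  (∀ t ∈ Ioi (0:ℝ), ux t 0 = 0 ∧ ux t 1 = 0)

/-- Nonnegativity of a solution on `[0,∞) × [0,1]`. -/
def KPPNonneg (u : ℝ → ℝ → ℝ) : Prop :=
  ∀ t ∈ Ici (0:ℝ), ∀ x ∈ Icc (0:ℝ) 1, 0 ≤ u t x

namespace KPP
open ProbabilityTheory Filter Topology

/-- standard gaussian measure -/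
noncomputable abbrev gam : Measure ℝ := gaussianReal 0 1

lemma integrable_abs_gam : Integrable (fun z : ℝ => |z|) gam := by
  have h := (memLp_id_gaussianReal (μ := 0) (v := 1) 1)
  have h2 : Integrable (id : ℝ → ℝ) gam := by
    rw [← memLp_one_iff_integrable]; exact_mod_cast h
  exact h2.abs

lemma integrable_of_lin {f : ℝ → ℝ} (hf : Continuous f) (A B : ℝ)
    (hb : ∀ z, |f z| ≤ A + B * |z|) : Integrable f gam := by
  refine Integrable.mono' (g := fun z => A + B * |z|) ?_ hf.aestronglyMeasurable
    (Eventually.of_forall fun z => by simpa using hb z)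
  exact (integrable_const A).add (integrable_abs_gam.const_mul B)

lemma integrable_of_quad {f : ℝ → ℝ} (hf : Continuous f) (A B : ℝ)
    (hb : ∀ z, |f z| ≤ A + B * z ^ 2) : Integrable f gam := by
  have h := (memLp_id_gaussianReal (μ := 0) (v := 1) 2)
  have h2 : Integrable (fun z : ℝ => z ^ 2) gam := by
    have := MemLp.integrable_sq (f := (id : ℝ → ℝ)) (μ := gam) (by exact_mod_cast h)
    simpa using this
  refine Integrable.mono' (g := fun z => A + B * z ^ 2) ?_ hf.aestronglyMeasurable
    (Eventually.of_forall fun z => by simpa using hb z)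
  exact (integrable_const A).add (h2.const_mul B)

lemma integrable_gam_iff (f : ℝ → ℝ) : Integrable f gam ↔
    Integrable (fun z => f z * gaussianPDFReal 0 1 z) := by
  rw [gam, gaussianReal_of_var_ne_zero 0 one_ne_zero,
    integrable_withDensity_iff (measurable_gaussianPDF 0 1)
      (Eventually.of_forall fun x => gaussianPDF_lt_top)]
  simp only [toReal_gaussianPDF]

lemma integral_gam (f : ℝ → ℝ) : ∫ z, f z ∂gam = ∫ z, f z * gaussianPDFReal 0 1 z := by
  rw [gam, integral_gaussianReal_eq_integral_smul one_ne_zero]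
  congr 1; ext z; simp [mul_comm]

lemma hasDerivAt_pdf (z : ℝ) :
    HasDerivAt (gaussianPDFReal 0 1) (- z * gaussianPDFReal 0 1 z) z := by
  rw [gaussianPDFReal_def]
  have h : HasDerivAt (fun x : ℝ => - (x - 0) ^ 2 / (2 * ((1 : NNReal) : ℝ))) (-z) z := by
    have := ((hasDerivAt_id z).sub_const (0:ℝ)).pow 2 |>.neg.div_const (2 * ((1 : NNReal) : ℝ))
    refine this.congr_deriv ?_
    simp
    ring
  have := (h.exp).const_mul ((√(2 * π * ((1 : NNReal) : ℝ)))⁻¹)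
  refine this.congr_deriv ?_
  ring

/-- Gaussian integration by parts. -/
lemma stein {G G' : ℝ → ℝ} (hG : ∀ z, HasDerivAt G (G' z) z) (hc : Continuous G')
    (C : ℝ) (hb : ∀ z, |G' z| ≤ C) : ∫ z, z * G z ∂gam = ∫ z, G' z ∂gam := by
  have hGc : Continuous G := continuous_iff_continuousAt.2 fun z => (hG z).continuousAt
  have hlin : ∀ z, |G z| ≤ |G 0| + C * |z| := by
    intro z
    have := Convex.norm_image_sub_le_of_norm_hasDerivWithin_le (f := G) (f' := G') (s := univ)
      (x := 0) (y := z) (C := C) (fun x _ => (hG x).hasDerivWithinAt) (fun x _ => by simpa using hb x)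
      convex_univ (mem_univ _) (mem_univ _)
    simp only [Real.norm_eq_abs, sub_zero] at this
    have h2 := abs_sub_abs_le_abs_sub (G z) (G 0)
    linarith
  have hC : 0 ≤ C := (abs_nonneg _).trans (hb 0)
  have i1 : Integrable (fun z => z * G z) gam := by
    refine integrable_of_quad (by fun_prop) (|G 0|) (|G 0| + C) fun z => ?_
    rw [abs_mul]
    have h1 := mul_le_mul_of_nonneg_left (hlin z) (abs_nonneg z)
    nlinarith [sq_abs z, abs_nonneg z, abs_nonneg (G 0), sq_nonneg (|z| - 1)]
  have i2 : Integrable G' gam := integrable_of_lin hc C 0 (by simpa using hb)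
  have i3 : Integrable G gam := integrable_of_lin hGc _ _ hlin
  rw [integrable_gam_iff] at i1 i2 i3
  rw [integral_gam, integral_gam]
  have key := integral_mul_deriv_eq_deriv_mul_of_integrable (u := G) (u' := G')
    (v := gaussianPDFReal 0 1) (v' := fun z => - z * gaussianPDFReal 0 1 z)
    (fun z _ => hG z) (fun z _ => hasDerivAt_pdf z)
    (by
      have := i1.neg
      refine this.congr (Eventually.of_forall fun z => ?_)
      simp; ring)
    i2 i3
  rw [← neg_eq_iff_eq_neg] at key
  rw [← key, ← MeasureTheory.integral_neg]
  congr 1; ext z; ring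

lemma cont_E {Y : Type*} [TopologicalSpace Y] [FirstCountableTopology Y] {F : Y → ℝ → ℝ}
    (hF : Continuous (fun p : Y × ℝ => F p.1 p.2)) (C : ℝ) (hb : ∀ y z, |F y z| ≤ C) :
    Continuous fun y => ∫ z, F y z ∂gam := by
  refine continuous_of_dominated (bound := fun _ => C) (fun y => ?_) (fun y => ?_)
    (integrable_const C) (Eventually.of_forall fun z => ?_)
  · exact (by fun_prop : Continuous fun z => F y z).aestronglyMeasurable
  · exact Eventually.of_forall fun z => by simpa using hb y z
  · fun_prop

lemma cont_EZ {Y : Type*} [TopologicalSpace Y] [FirstCountableTopology Y] {F : Y → ℝ → ℝ}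
    (hF : Continuous (fun p : Y × ℝ => F p.1 p.2)) (C : ℝ) (hb : ∀ y z, |F y z| ≤ C) :
    Continuous fun y => ∫ z, z * F y z ∂gam := by
  refine continuous_of_dominated (bound := fun z => |z| * C) (fun y => ?_) (fun y => ?_)
    (integrable_abs_gam.mul_const C) (Eventually.of_forall fun z => ?_)
  · exact (by fun_prop : Continuous fun z => z * F y z).aestronglyMeasurable
  · refine Eventually.of_forall fun z => ?_
    rw [Real.norm_eq_abs, abs_mul]
    exact mul_le_mul_of_nonneg_left (hb y z) (abs_nonneg z)
  · fun_prop

/-- Gaussian averaging -/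
noncomputable def P (f : ℝ → ℝ) (a x : ℝ) : ℝ := ∫ z, f (x + a * z) ∂gam
/-- weighted gaussian averaging -/
noncomputable def Q (f : ℝ → ℝ) (a x : ℝ) : ℝ := ∫ z, z * f (x + a * z) ∂gam

lemma P_zero (f : ℝ → ℝ) (x : ℝ) : P f 0 x = f x := by simp [P]

lemma P_bound {f : ℝ → ℝ} {C : ℝ} (hb : ∀ x, |f x| ≤ C) (a x : ℝ) : |P f a x| ≤ C := by
  have := norm_integral_le_of_norm_le_const (μ := gam) (f := fun z => f (x + a * z)) (C := C)
    (Eventually.of_forall fun z => by simpa using hb _)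
  simpa [P] using this

lemma P_deriv {f f' : ℝ → ℝ} (hf : ∀ x, HasDerivAt f (f' x) x) (hc : Continuous f')
    {C : ℝ} (hb : ∀ x, |f x| ≤ C) {C' : ℝ} (hb' : ∀ x, |f' x| ≤ C') (a x : ℝ) :
    HasDerivAt (P f a) (P f' a x) x := by
  have hfc : Continuous f := continuous_iff_continuousAt.2 fun z => (hf z).continuousAt
  refine (_root_.hasDerivAt_integral_of_dominated_loc_of_deriv_le (μ := gam)
    (F := fun x z => f (x + a * z)) (F' := fun x z => f' (x + a * z)) (bound := fun _ => C')
    (s := univ) univ_mem ?_ ?_ ?_ ?_ ?_ ?_).2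
  · exact Eventually.of_forall fun x => (by fun_prop : Continuous _).aestronglyMeasurable
  · exact integrable_of_lin (by fun_prop) C 0 (by intro z; simpa using hb _)
  · exact (by fun_prop : Continuous _).aestronglyMeasurable
  · exact Eventually.of_forall fun z x _ => by simpa using hb' _
  · exact integrable_const C'
  · refine Eventually.of_forall fun z x _ => ?_
    exact (hf (x + a * z)).comp_add_const x (a * z)

lemma Q_deriv {f f' : ℝ → ℝ} (hf : ∀ x, HasDerivAt f (f' x) x) (hc : Continuous f')
    {C' : ℝ} (hb' : ∀ x, |f' x| ≤ C') (a x : ℝ)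
    (hi : Integrable (fun z => z * f (x + a * z)) gam) :
    HasDerivAt (Q f a) (Q f' a x) x := by
  have hfc : Continuous f := continuous_iff_continuousAt.2 fun z => (hf z).continuousAt
  refine (_root_.hasDerivAt_integral_of_dominated_loc_of_deriv_le (μ := gam)
    (F := fun x z => z * f (x + a * z)) (F' := fun x z => z * f' (x + a * z))
    (bound := fun z => |z| * C')
    (s := univ) univ_mem ?_ hi ?_ ?_ ?_ ?_).2
  · exact Eventually.of_forall fun x => (by fun_prop : Continuous _).aestronglyMeasurable
  · exact (by fun_prop : Continuous _).aestronglyMeasurable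
  · refine Eventually.of_forall fun z x _ => ?_
    rw [Real.norm_eq_abs, abs_mul]
    exact mul_le_mul_of_nonneg_left (hb' _) (abs_nonneg z)
  · exact (integrable_abs_gam.mul_const C')
  · refine Eventually.of_forall fun z x _ => ?_
    exact ((hf (x + a * z)).comp_add_const x (a * z)).const_mul z

lemma P_deriv_a {f f' : ℝ → ℝ} (hf : ∀ x, HasDerivAt f (f' x) x) (hc : Continuous f')
    {C : ℝ} (hb : ∀ x, |f x| ≤ C) {C' : ℝ} (hb' : ∀ x, |f' x| ≤ C') (a x : ℝ) :
    HasDerivAt (fun a => P f a x) (Q f' a x) a := by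
  have hfc : Continuous f := continuous_iff_continuousAt.2 fun z => (hf z).continuousAt
  refine (_root_.hasDerivAt_integral_of_dominated_loc_of_deriv_le (μ := gam)
    (F := fun a z => f (x + a * z)) (F' := fun a z => z * f' (x + a * z))
    (bound := fun z => |z| * C')
    (s := univ) univ_mem ?_ ?_ ?_ ?_ ?_ ?_).2
  · exact Eventually.of_forall fun x => (by fun_prop : Continuous _).aestronglyMeasurable
  · exact integrable_of_lin (by fun_prop) C 0 (by intro z; simpa using hb _)
  · exact (by fun_prop : Continuous _).aestronglyMeasurable
  · refine Eventually.of_forall fun z x _ => ?_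
    rw [Real.norm_eq_abs, abs_mul]
    exact mul_le_mul_of_nonneg_left (hb' _) (abs_nonneg z)
  · exact (integrable_abs_gam.mul_const C')
  · refine Eventually.of_forall fun z b _ => ?_
    have h1 : HasDerivAt (fun b : ℝ => x + b * z) z b := by
      simpa using ((hasDerivAt_id b).mul_const z).const_add x
    have := (hf (x + b * z)).comp b h1
    exact this.congr_deriv (by ring)

/-- Stein identity for `P`, `Q`. -/
lemma Q_eq {f f' : ℝ → ℝ} (hf : ∀ x, HasDerivAt f (f' x) x) (hc : Continuous f')
    {C' : ℝ} (hb' : ∀ x, |f' x| ≤ C') (a x : ℝ) : Q f a x = a * P f' a x := by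
  have := stein (G := fun z => f (x + a * z)) (G' := fun z => a * f' (x + a * z))
    (fun z => by
      have h1 : HasDerivAt (fun b : ℝ => x + a * b) a z := by
        simpa using ((hasDerivAt_id z).const_mul a).const_add x
      have := (hf (x + a * z)).comp z h1
      exact this.congr_deriv (by ring)) (by fun_prop) (|a| * C') (fun z => by
      rw [abs_mul]
      exact mul_le_mul_of_nonneg_left (hb' _) (abs_nonneg a))
  rw [Q, this, MeasureTheory.integral_const_mul, P]

/-- smoothing -/
lemma aP_deriv {f : ℝ → ℝ} (hc : Continuous f) {C : ℝ} (hb : ∀ x, |f x| ≤ C) (a x : ℝ) :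
    HasDerivAt (fun x => a * P f a x) (Q f a x) x := by
  set Fa : ℝ → ℝ := fun x => ∫ y in (0:ℝ)..x, f y with hFa
  have hd : ∀ x, HasDerivAt Fa (f x) x := fun x =>
    intervalIntegral.integral_hasDerivAt_right (hc.intervalIntegrable _ _)
      (hc.stronglyMeasurableAtFilter _ _) hc.continuousAt
  have hFc : Continuous Fa := continuous_iff_continuousAt.2 fun z => (hd z).continuousAt
  have heq : (fun x => a * P f a x) = Q Fa a := by
    ext x; rw [Q_eq hd hc hb]
  rw [heq]
  refine Q_deriv hd hc hb a x ?_
  have hlin : ∀ y, |Fa y| ≤ C * |y| := by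
    intro y
    have := intervalIntegral.norm_integral_le_of_norm_le_const (f := f) (a := 0) (b := y) (C := C)
      (fun z _ => by simpa using hb z)
    simpa using this
  have hC : 0 ≤ C := (abs_nonneg _).trans (hb 0)
  refine integrable_of_quad (by fun_prop) (C * |x|) (C * |x| + C * |a|) fun z => ?_
  rw [abs_mul]
  have h1 := hlin (x + a * z)
  have h2 : |x + a * z| ≤ |x| + |a| * |z| := by
    simpa [abs_mul] using abs_add_le x (a * z)
  have h3 : |Fa (x + a * z)| ≤ C * |x| + C * |a| * |z| := by
    nlinarith [mul_le_mul_of_nonneg_left h2 hC]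
  have h4 := mul_le_mul_of_nonneg_left h3 (abs_nonneg z)
  have h5 : 0 ≤ C * |x| := by positivity
  have h6 : |z| ≤ 1 + z ^ 2 := by nlinarith [sq_abs z, sq_nonneg (|z| - 1)]
  have h7 : |z| * |z| = z ^ 2 := by rw [← sq, sq_abs]
  calc _ ≤ _ := h4
    _ = C * |x| * |z| + C * |a| * (|z| * |z|) := by ring
    _ ≤ _ := by rw [h7]; nlinarith [mul_le_mul_of_nonneg_left h6 h5]

/-- semigroup property -/
lemma P_P {f : ℝ → ℝ} (hc : Continuous f) {C : ℝ} (hb : ∀ x, |f x| ≤ C) {s t : ℝ}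
    (hs : 0 ≤ s) (ht : 0 ≤ t) (x : ℝ) :
    P (P f √(2 * s)) √(2 * t) x = P f √(2 * (s + t)) x := by
  have key : ∀ r : ℝ, 0 ≤ r → ∀ (k : ℝ → ℝ), Continuous k → ∫ z, k (√(2 * r) * z) ∂gam
      = ∫ z, k z ∂(gaussianReal 0 (2 * r).toNNReal) := by
    intro r hr k hk
    have := gaussianReal_map_const_mul (μ := 0) (v := 1) √(2 * r)
    have h2 : (NNReal.mk ((√(2 * r)) ^ 2) (sq_nonneg _)) * 1 = (2 * r).toNNReal := by
      ext; simp [mul_pow, hr]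
    rw [mul_zero] at this
    rw [← h2]
    erw [← this]
    rw [integral_map (by fun_prop) (by fun_prop)]
  have hPc : Continuous (P f √(2 * s)) :=
    cont_E (F := fun x z => f (x + √(2 * s) * z)) (by fun_prop) C (fun y z => hb _)
  have e1 : P (P f √(2 * s)) √(2 * t) x = ∫ y, (∫ z, f (x + y + z) ∂(gaussianReal 0 (2 * s).toNNReal))
      ∂(gaussianReal 0 (2 * t).toNNReal) := by
    rw [P, key t ht (fun y => P f √(2 * s) (x + y)) (by fun_prop)]
    congr 1; ext y
    rw [P, key s hs (fun z => f (x + y + z)) (by fun_prop)]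
  rw [e1, P, key (s + t) (by positivity) (fun z => f (x + z)) (by fun_prop)]
  have h3 : gaussianReal 0 (2 * (s + t)).toNNReal
      = (gaussianReal 0 (2 * t).toNNReal) ∗ (gaussianReal 0 (2 * s).toNNReal) := by
    rw [gaussianReal_conv_gaussianReal, ← Real.toNNReal_add (by positivity) (by positivity)]
    congr 2
    · simp
    · ring
  rw [h3, integral_conv]
  · simp only [add_assoc]
  · rw [← h3]
    refine Integrable.mono' (g := fun _ => C) (integrable_const C) ?_
      (Eventually.of_forall fun z => by simpa using hb _)
    exact (by fun_prop : Continuous _).aestronglyMeasurable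

lemma P_neg (f : ℝ → ℝ) (a x : ℝ) : P f (-a) x = P f a x := by
  have h := gaussianReal_map_neg (μ := 0) (v := 1)
  rw [neg_zero] at h
  have e : MeasurableEmbedding (fun z : ℝ => -z) := (Homeomorph.neg ℝ).measurableEmbedding
  have := e.integral_map (μ := gam) (fun z => f (x + a * z))
  rw [gam, h] at this
  rw [P, P, this]
  simp

end KPP

namespace KPP
set_option linter.unusedSectionVars false
set_option linter.unusedTactic false
open ProbabilityTheory Filter Topology

/-- differentiation under the integral sign, compact version -/
lemma param_deriv {k k' : ℝ → ℝ → ℝ} {S : Set ℝ} {x₀ a b : ℝ} (hS : S ∈ 𝓝 x₀) (hSc : IsCompact S)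
    (hk : ContinuousOn (fun p : ℝ × ℝ => k p.1 p.2) (S ×ˢ uIcc a b))
    (hk' : ContinuousOn (fun p : ℝ × ℝ => k' p.1 p.2) (S ×ˢ uIcc a b))
    (hd : ∀ x ∈ S, ∀ r ∈ uIcc a b, HasDerivAt (fun x => k x r) (k' x r) x) :
    HasDerivAt (fun x => ∫ r in a..b, k x r) (∫ r in a..b, k' x₀ r) x₀ := by
  obtain ⟨C, hC⟩ := (hSc.prod (isCompact_uIcc (a := a) (b := b))).exists_bound_of_continuousOn hk'
  have sl : ∀ {f : ℝ → ℝ → ℝ}, ContinuousOn (fun p : ℝ × ℝ => f p.1 p.2) (S ×ˢ uIcc a b) →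
      ∀ x ∈ S, ContinuousOn (f x) (uIcc a b) := by
    intro f hf x hx
    exact hf.comp (f := fun r => (x, r)) (by fun_prop) (fun r hr => ⟨hx, hr⟩)
  have sub : uIoc a b ⊆ uIcc a b := uIoc_subset_uIcc
  refine (intervalIntegral.hasDerivAt_integral_of_dominated_loc_of_deriv_le (bound := fun _ => C)
    (F := k) (F' := k') hS ?_ ?_ ?_ ?_ ?_ ?_).2
  · filter_upwards [hS] with x hx
    exact ((sl hk x hx).mono sub).aestronglyMeasurable measurableSet_uIoc
  · exact (sl hk _ (mem_of_mem_nhds hS)).intervalIntegrable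
  · exact ((sl hk' _ (mem_of_mem_nhds hS)).mono sub).aestronglyMeasurable measurableSet_uIoc
  · exact Eventually.of_forall fun r hr x hx => hC (x, r) ⟨hx, sub hr⟩
  · exact intervalIntegrable_const
  · exact Eventually.of_forall fun r hr x hx => hd x hx r (sub hr)

lemma param_deriv' {k k' : ℝ → ℝ → ℝ} {x₀ a b : ℝ}
    (hk : Continuous (fun p : ℝ × ℝ => k p.1 p.2))
    (hk' : Continuous (fun p : ℝ × ℝ => k' p.1 p.2))
    (hd : ∀ x, ∀ r ∈ uIcc a b, HasDerivAt (fun x => k x r) (k' x r) x) :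
    HasDerivAt (fun x => ∫ r in a..b, k x r) (∫ r in a..b, k' x₀ r) x₀ :=
  param_deriv (S := Icc (x₀ - 1) (x₀ + 1)) (Icc_mem_nhds (by linarith) (by linarith)) isCompact_Icc
    hk.continuousOn hk'.continuousOn (fun x _ r hr => hd x r hr)

/-- Duhamel term -/
noncomputable def Duh (g : ℝ → ℝ → ℝ) (t x : ℝ) : ℝ := ∫ s in (0:ℝ)..t, P (g s) √(2 * (t - s)) x
/-- mild solution operator -/
noncomputable def mild (h : ℝ → ℝ) (g : ℝ → ℝ → ℝ) (t x : ℝ) : ℝ := P h √(2 * t) x + Duh g t x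
/-- derivative of the Duhamel term -/
noncomputable def DuhX (g : ℝ → ℝ → ℝ) (t x : ℝ) : ℝ :=
  ∫ r in (0:ℝ)..√t, √2 * Q (g (t - r ^ 2)) (√2 * r) x
/-- derivative of the mild solution -/
noncomputable def MX (h : ℝ → ℝ) (g : ℝ → ℝ → ℝ) (t x : ℝ) : ℝ :=
  Q h √(2 * t) x / √(2 * t) + DuhX g t x

section
variable {g : ℝ → ℝ → ℝ} {C : ℝ} (hg : Continuous (fun p : ℝ × ℝ => g p.1 p.2))
  (hb : ∀ s y, |g s y| ≤ C)
include hg hb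

lemma P_cont {Y : Type*} [TopologicalSpace Y] [FirstCountableTopology Y] {s a x : Y → ℝ}
    (hs : Continuous s) (ha : Continuous a) (hx : Continuous x) :
    Continuous fun y => P (g (s y)) (a y) (x y) :=
  cont_E (F := fun y z => g (s y) (x y + a y * z))
    (hg.comp (f := fun p : Y × ℝ => (s p.1, x p.1 + a p.1 * p.2)) (by fun_prop)) C
    (fun y z => hb _ _)

lemma Q_cont {Y : Type*} [TopologicalSpace Y] [FirstCountableTopology Y] {s a x : Y → ℝ}
    (hs : Continuous s) (ha : Continuous a) (hx : Continuous x) :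
    Continuous fun y => Q (g (s y)) (a y) (x y) :=
  cont_EZ (F := fun y z => g (s y) (x y + a y * z))
    (hg.comp (f := fun p : Y × ℝ => (s p.1, x p.1 + a p.1 * p.2)) (by fun_prop)) C
    (fun y z => hb _ _)

lemma Duh_cont : Continuous fun p : ℝ × ℝ => Duh g p.1 p.2 := by
  refine continuous_parametric_intervalIntegral_of_continuous
    (f := fun (p : ℝ × ℝ) s => P (g s) √(2 * (p.1 - s)) p.2) ?_ continuous_fst
  exact P_cont hg hb (s := fun q : (ℝ × ℝ) × ℝ => q.2) (a := fun q => √(2 * (q.1.1 - q.2)))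
    (x := fun q => q.1.2) (by fun_prop) (by fun_prop) (by fun_prop)

lemma DuhX_cont : Continuous fun p : ℝ × ℝ => DuhX g p.1 p.2 := by
  refine continuous_parametric_intervalIntegral_of_continuous
    (f := fun (p : ℝ × ℝ) r => √2 * Q (g (p.1 - r ^ 2)) (√2 * r) p.2) ?_
    (s := fun p : ℝ × ℝ => √p.1) (by fun_prop)
  exact continuous_const.mul (Q_cont hg hb (s := fun q : (ℝ × ℝ) × ℝ => q.1.1 - q.2 ^ 2)
    (a := fun q => √2 * q.2)
    (x := fun q => q.1.2) (by fun_prop) (by fun_prop) (by fun_prop))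

lemma Duh_rho {t : ℝ} (ht : 0 ≤ t) (x : ℝ) :
    Duh g t x = ∫ r in (0:ℝ)..√t, √2 * ((√2 * r) * P (g (t - r ^ 2)) (√2 * r) x) := by
  have hc : Continuous fun s => P (g s) √(2 * (t - s)) x :=
    P_cont hg hb (s := fun s : ℝ => s) (a := fun s => √(2 * (t - s)))
      (x := fun _ => x) (by fun_prop) (by fun_prop) (by fun_prop)
  have key := intervalIntegral.integral_comp_mul_deriv (a := 0) (b := √t)
    (f := fun r => t - r ^ 2) (f' := fun r => - (2 * r))
    (g := fun s => P (g s) √(2 * (t - s)) x)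
    (fun r _ => by simpa using ((hasDerivAt_id r).pow 2).const_sub t) (by fun_prop) hc
  simp only [Real.sq_sqrt ht, sub_self] at key
  have e0 : t - 0 ^ 2 = t := by ring
  rw [e0] at key
  rw [Duh, intervalIntegral.integral_symm, ← key, ← intervalIntegral.integral_neg]
  refine intervalIntegral.integral_congr fun r hr => ?_
  rw [uIcc_of_le (Real.sqrt_nonneg t)] at hr
  have h1 : √(2 * (t - (t - r ^ 2))) = √2 * r := by
    rw [show 2 * (t - (t - r ^ 2)) = 2 * r ^ 2 by ring, Real.sqrt_mul (by norm_num),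
      Real.sqrt_sq hr.1]
  have h2 : √2 * √2 = 2 := Real.mul_self_sqrt (by norm_num)
  simp only [Function.comp, h1]
  rw [← mul_assoc, ← mul_assoc, h2]; ring

lemma Duh_deriv {t : ℝ} (ht : 0 ≤ t) (x : ℝ) : HasDerivAt (Duh g t) (DuhX g t x) x := by
  have : Duh g t = fun x => ∫ r in (0:ℝ)..√t, √2 * ((√2 * r) * P (g (t - r ^ 2)) (√2 * r) x) :=
    funext fun x => Duh_rho hg hb ht x
  rw [this]
  refine param_deriv' (k := fun x r => √2 * ((√2 * r) * P (g (t - r ^ 2)) (√2 * r) x))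
    (k' := fun x r => √2 * Q (g (t - r ^ 2)) (√2 * r) x) ?_ ?_ ?_
  · have := P_cont hg hb (s := fun q : ℝ × ℝ => t - q.2 ^ 2) (a := fun q => √2 * q.2)
      (x := fun q => q.1) (by fun_prop) (by fun_prop) (by fun_prop)
    fun_prop
  · have := Q_cont hg hb (s := fun q : ℝ × ℝ => t - q.2 ^ 2) (a := fun q => √2 * q.2)
      (x := fun q => q.1) (by fun_prop) (by fun_prop) (by fun_prop)
    fun_prop
  · intro x r _
    refine (aP_deriv (f := g (t - r ^ 2)) ?_ (hb _) (√2 * r) x).const_mul _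
    exact hg.comp (f := fun y => (t - r ^ 2, y)) (by fun_prop)

variable {h : ℝ → ℝ} {C₀ : ℝ} (hh : Continuous h) (hhb : ∀ y, |h y| ≤ C₀)
include hh hhb

lemma mild_cont : Continuous fun p : ℝ × ℝ => mild h g p.1 p.2 := by
  refine Continuous.add ?_ (Duh_cont hg hb)
  exact P_cont (g := fun _ => h) (hh.comp continuous_snd) (fun _ => hhb) (s := fun p : ℝ × ℝ => 0)
    (a := fun p => √(2 * p.1)) (x := fun p => p.2) (by fun_prop) (by fun_prop) (by fun_prop)

lemma mild_bound (t x : ℝ) : |mild h g t x| ≤ C₀ + C * |t| := by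
  refine (abs_add_le _ _).trans (add_le_add (P_bound hhb _ _) ?_)
  have := intervalIntegral.norm_integral_le_of_norm_le_const (a := 0) (b := t) (C := C)
    (f := fun s => P (g s) √(2 * (t - s)) x) (fun s _ => P_bound (hb s) _ _)
  simpa [Duh] using this

lemma mild_deriv_pos {t : ℝ} (ht : 0 < t) (x : ℝ) : HasDerivAt (mild h g t) (MX h g t x) x := by
  refine HasDerivAt.add ?_ (Duh_deriv hg hb ht.le x)
  have h1 := (aP_deriv hh hhb √(2 * t) x).div_const √(2 * t)
  have h2 : √(2 * t) ≠ 0 := (Real.sqrt_pos.2 (by positivity)).ne'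
  refine h1.congr_of_eventuallyEq (Eventually.of_forall fun y => ?_)
  simp only []
  field_simp

lemma MX_cont : ContinuousOn (fun p : ℝ × ℝ => MX h g p.1 p.2) (Ioi 0 ×ˢ univ) := by
  refine ContinuousOn.add (ContinuousOn.div ?_ (by fun_prop) ?_) (DuhX_cont hg hb).continuousOn
  · exact (Q_cont (g := fun _ => h) (hh.comp continuous_snd) (fun _ => hhb)
      (s := fun p : ℝ × ℝ => 0) (a := fun p => √(2 * p.1)) (x := fun p => p.2)
      (by fun_prop) (by fun_prop) (by fun_prop)).continuousOn
  · rintro ⟨t, x⟩ ⟨ht, -⟩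
    exact (Real.sqrt_pos.2 (by simpa using ht)).ne'

lemma mild_restart {t τ : ℝ} (ht : 0 ≤ t) (hτ : 0 ≤ τ) (x : ℝ) :
    mild h g (t + τ) x = mild (mild h g t) (fun s => g (t + s)) τ x := by
  have c1 : ∀ r, Continuous (fun s => P (g s) √(2 * (r - s)) x) := fun r =>
    P_cont hg hb (s := fun s : ℝ => s) (a := fun s => √(2 * (r - s)))
      (x := fun _ => x) (by fun_prop) (by fun_prop) (by fun_prop)
  have e1 : Duh g (t + τ) x = (∫ s in (0:ℝ)..t, P (g s) √(2 * (t + τ - s)) x)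
      + Duh (fun s => g (t + s)) τ x := by
    rw [Duh, ← intervalIntegral.integral_add_adjacent_intervals
      ((c1 _).intervalIntegrable 0 t) ((c1 _).intervalIntegrable t (t + τ))]
    congr 1
    have := intervalIntegral.integral_comp_add_left (a := 0) (b := τ)
      (fun s => P (g s) √(2 * (t + τ - s)) x) t
    rw [add_zero] at this
    rw [← this, Duh]
    refine intervalIntegral.integral_congr fun s _ => ?_
    change P (g (t + s)) √(2 * (t + τ - (t + s))) x = P (g (t + s)) √(2 * (τ - s)) x
    congr 3; ring
  have hDc : Continuous (Duh g t) :=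
    (Duh_cont hg hb).comp (f := fun x => (t, x)) (by fun_prop)
  have hPc : Continuous (P h √(2 * t)) :=
    P_cont (g := fun _ => h) (hh.comp continuous_snd) (fun _ => hhb) (s := fun p : ℝ => 0)
      (a := fun p => √(2 * t)) (x := fun p => p) (by fun_prop) (by fun_prop) (by fun_prop)
  have hDb : ∀ y, |Duh g t y| ≤ C * |t| := by
    intro y
    have := intervalIntegral.norm_integral_le_of_norm_le_const (a := 0) (b := t) (C := C)
      (f := fun s => P (g s) √(2 * (t - s)) y) (fun s _ => P_bound (hb s) _ _)
    simpa [Duh] using this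
  have e2 : P (mild h g t) √(2 * τ) x = P (P h √(2 * t)) √(2 * τ) x + P (Duh g t) √(2 * τ) x := by
    unfold P mild
    rw [← MeasureTheory.integral_add]
    · rfl
    · exact integrable_of_lin (hPc.comp (by fun_prop)) C₀ 0
        (fun z => by rw [zero_mul, add_zero]; exact P_bound hhb _ _)
    · exact integrable_of_lin (hDc.comp (by fun_prop)) (C * |t|) 0 (fun z => by simpa using hDb _)
  have e3 : P (Duh g t) √(2 * τ) x = ∫ s in (0:ℝ)..t, P (g s) √(2 * (t + τ - s)) x := by
    have : P (Duh g t) √(2 * τ) x = ∫ s in (0:ℝ)..t, P (P (g s) √(2 * (t - s))) √(2 * τ) x := by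
      unfold P Duh
      rw [intervalIntegral_integral_swap]
      · rfl
      · have hcc : Continuous fun p : ℝ × ℝ =>
            P (g p.1) √(2 * (t - p.1)) (x + √(2 * τ) * p.2) :=
          P_cont hg hb (s := fun p : ℝ × ℝ => p.1) (a := fun p => √(2 * (t - p.1)))
            (x := fun p => x + √(2 * τ) * p.2) (by fun_prop) (by fun_prop) (by fun_prop)
        have : IsFiniteMeasure (volume.restrict (uIoc 0 t)) :=
          ⟨by rw [Measure.restrict_apply_univ]; exact measure_Ioc_lt_top⟩
        refine Integrable.mono' (g := fun _ => C) (integrable_const C) ?_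
          (Eventually.of_forall fun p => P_bound (hb _) _ _)
        exact hcc.aestronglyMeasurable
    rw [this]
    refine intervalIntegral.integral_congr fun s hs => ?_
    rw [uIcc_of_le ht] at hs
    change P (P (g s) √(2 * (t - s))) √(2 * τ) x = P (g s) √(2 * (t + τ - s)) x
    rw [P_P (f := g s) (hg.comp (f := fun y => (s, y)) (by fun_prop)) (hb s)
      (by linarith [hs.2]) hτ]
    congr 3; ring
  unfold mild at *
  rw [e2, e3, e1, P_P hh hhb ht hτ]
  ring

variable {h' : ℝ → ℝ} {g' : ℝ → ℝ → ℝ} {C' C₀' : ℝ} (hd : ∀ y, HasDerivAt h (h' y) y)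
  (hh' : Continuous h') (hhb' : ∀ y, |h' y| ≤ C₀')

include hd hh' hhb' in
lemma mild_deriv (hg' : Continuous (fun p : ℝ × ℝ => g' p.1 p.2)) (hb' : ∀ s y, |g' s y| ≤ C')
    (hgd : ∀ s y, HasDerivAt (g s) (g' s y) y) (t x : ℝ) :
    HasDerivAt (mild h g t) (mild h' g' t x) x := by
  refine HasDerivAt.add (P_deriv hd hh' hhb hhb' _ _) ?_
  refine param_deriv' (k := fun x s => P (g s) √(2 * (t - s)) x)
    (k' := fun x s => P (g' s) √(2 * (t - s)) x) ?_ ?_ ?_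
  · exact P_cont hg hb (s := fun p : ℝ × ℝ => p.2) (a := fun p => √(2 * (t - p.2)))
      (x := fun p => p.1) (by fun_prop) (by fun_prop) (by fun_prop)
  · exact P_cont hg' hb' (s := fun p : ℝ × ℝ => p.2) (a := fun p => √(2 * (t - p.2)))
      (x := fun p => p.1) (by fun_prop) (by fun_prop) (by fun_prop)
  · intro x s _
    exact P_deriv (hgd s) (hg'.comp (f := fun y => (s, y)) (by fun_prop)) (hb s) (hb' s) _ _

include hd hh' hhb' in
lemma mild_right_deriv {h'' : ℝ → ℝ} {C₀'' : ℝ} (hd' : ∀ y, HasDerivAt h' (h'' y) y)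
    (hh'' : Continuous h'') (hhb'' : ∀ y, |h'' y| ≤ C₀'') (x : ℝ) :
    HasDerivWithinAt (fun τ => mild h g τ x) (h'' x + g 0 x) (Ici 0) 0 := by
  refine HasDerivWithinAt.add ?_ ?_
  · -- semigroup part
    have hcP : ∀ {k : ℝ → ℝ} {D : ℝ}, Continuous k → (∀ y, |k y| ≤ D) →
        Continuous fun τ : ℝ => P k √(2 * τ) x := by
      intro k D hk hkb
      exact P_cont (g := fun _ => k) (hk.comp continuous_snd) (fun _ => hkb) (s := fun p : ℝ => 0)
        (a := fun p => √(2 * p)) (x := fun p => x) (by fun_prop) (by fun_prop) (by fun_prop)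
    have hder : ∀ τ ∈ Ioi (0:ℝ), HasDerivAt (fun τ => P h √(2 * τ) x) (P h'' √(2 * τ) x) τ := by
      intro τ hτ
      have hτ' : 0 < 2 * τ := by simpa using hτ
      have h1 : HasDerivAt (fun τ : ℝ => √(2 * τ)) (1 / √(2 * τ)) τ := by
        have := ((hasDerivAt_id τ).const_mul 2).sqrt hτ'.ne'
        refine this.congr_deriv ?_
        simp only [id]; field_simp
      have h2 := (P_deriv_a hd hh' hhb hhb' √(2 * τ) x).comp τ h1
      refine h2.congr_deriv ?_
      rw [Q_eq hd' hh'' hhb'']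
      have := (Real.sqrt_pos.2 hτ').ne'
      field_simp
    refine hasDerivWithinAt_Ici_of_tendsto_deriv (s := Ioi 0)
      (fun τ hτ => (hder τ hτ).differentiableAt.differentiableWithinAt)
      (hcP hh hhb).continuousWithinAt self_mem_nhdsWithin ?_
    have h3 : Tendsto (fun τ => P h'' √(2 * τ) x) (𝓝[>] 0) (𝓝 (h'' x)) := by
      have := ((hcP hh'' hhb'').tendsto 0).mono_left (nhdsWithin_le_nhds (s := Ioi 0))
      simpa [P_zero] using this
    refine h3.congr' ?_
    filter_upwards [self_mem_nhdsWithin] with τ hτ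
    exact ((hder τ hτ).deriv).symm
  · -- Duhamel part
    refine HasDerivAt.hasDerivWithinAt ?_
    have e : (fun τ => Duh g τ x) = fun τ => τ * ∫ θ in (0:ℝ)..1, P (g (τ * θ)) √(2 * (τ - τ * θ)) x := by
      ext τ
      have := intervalIntegral.mul_integral_comp_mul_left (a := 0) (b := 1)
        (f := fun s => P (g s) √(2 * (τ - s)) x) τ
      simp only [mul_zero, mul_one] at this
      rw [this, Duh]
    rw [e]
    set I : ℝ → ℝ := fun τ => ∫ θ in (0:ℝ)..1, P (g (τ * θ)) √(2 * (τ - τ * θ)) x with hI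
    have hIc : Continuous I := by
      refine continuous_parametric_intervalIntegral_of_continuous'
        (f := fun (τ : ℝ) θ => P (g (τ * θ)) √(2 * (τ - τ * θ)) x) ?_ 0 1
      exact P_cont hg hb (s := fun p : ℝ × ℝ => p.1 * p.2) (a := fun p => √(2 * (p.1 - p.1 * p.2)))
        (x := fun p => x) (by fun_prop) (by fun_prop) (by fun_prop)
    have hI0 : I 0 = g 0 x := by simp [hI, P_zero]
    rw [hasDerivAt_iff_tendsto_slope]
    have h4 : Tendsto I (𝓝[≠] 0) (𝓝 (g 0 x)) := by
      rw [← hI0]; exact (hIc.tendsto 0).mono_left nhdsWithin_le_nhds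
    refine h4.congr' ?_
    filter_upwards [self_mem_nhdsWithin] with τ hτ
    have : τ ≠ 0 := hτ
    change I τ = (τ - 0)⁻¹ • (τ * I τ - 0 * I 0)
    simp [this]

end

/-- continuous right derivative implies derivative -/
lemma deriv_of_right {f f' : ℝ → ℝ} (hf : ContinuousOn f (Ioi 0)) (hf' : ContinuousOn f' (Ioi 0))
    (hd : ∀ t ∈ Ioi (0:ℝ), HasDerivWithinAt f (f' t) (Ioi t) t) {t : ℝ} (ht : 0 < t) :
    HasDerivAt f (f' t) t := by
  have hsub : ∀ r > (0:ℝ), uIcc (t / 2) r ⊆ Ioi 0 := by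
    intro r hr y hy
    exact lt_of_lt_of_le (lt_min (by linarith) hr) hy.1
  have h1 : ∀ r ∈ Ioi (0:ℝ), f r = f (t / 2) + ∫ s in (t / 2)..r, f' s := by
    intro r hr
    rw [intervalIntegral.integral_eq_sub_of_hasDeriv_right (hf.mono (hsub r hr))
      (fun y hy => hd y (hsub r hr (Ioo_subset_Icc_self hy)))
      ((hf'.mono (hsub r hr)).intervalIntegrable)]
    ring
  have h2 : HasDerivAt (fun r => f (t / 2) + ∫ s in (t / 2)..r, f' s) (f' t) t := by
    refine HasDerivAt.const_add _ ?_
    refine intervalIntegral.integral_hasDerivAt_right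
      ((hf'.mono (hsub t ht)).intervalIntegrable) ?_ (hf'.continuousAt (Ioi_mem_nhds ht))
    exact hf'.stronglyMeasurableAtFilter isOpen_Ioi t ht
  refine h2.congr_of_eventuallyEq ?_
  filter_upwards [Ioi_mem_nhds ht] with r hr using h1 r hr

end KPP

namespace KPP
open ProbabilityTheory Filter Topology

lemma P_periodic {f : ℝ → ℝ} (hf : ∀ x, f (x + 2) = f x) (a x : ℝ) : P f a (x + 2) = P f a x := by
  unfold P
  congr 1; ext z
  rw [show x + 2 + a * z = x + a * z + 2 by ring, hf]

lemma P_even {f : ℝ → ℝ} (hf : ∀ x, f (-x) = f x) (a x : ℝ) : P f a (-x) = P f a x := by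
  rw [← P_neg f a x]
  unfold P
  congr 1; ext z
  rw [← hf]; congr 1; ring

lemma mild_periodic {h : ℝ → ℝ} {g : ℝ → ℝ → ℝ} (hh : ∀ x, h (x + 2) = h x)
    (hg : ∀ s x, g s (x + 2) = g s x) (t x : ℝ) : mild h g t (x + 2) = mild h g t x := by
  unfold mild Duh
  rw [P_periodic hh]
  congr 2; ext s
  rw [P_periodic (hg s)]

lemma mild_even {h : ℝ → ℝ} {g : ℝ → ℝ → ℝ} (hh : ∀ x, h (-x) = h x)
    (hg : ∀ s x, g s (-x) = g s x) (t x : ℝ) : mild h g t (-x) = mild h g t x := by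
  unfold mild Duh
  rw [P_even hh]
  congr 2; ext s
  rw [P_even (hg s)]

lemma deriv_periodic {f f' : ℝ → ℝ} (hf : ∀ x, f (x + 2) = f x) (hd : ∀ x, HasDerivAt f (f' x) x)
    (x : ℝ) : f' (x + 2) = f' x := by
  have h1 := (hd (x + 2)).comp_add_const x 2
  rw [show (fun x => f (x + 2)) = f from funext hf] at h1
  exact h1.unique (hd x)

lemma periodic_bound {k : ℝ → ℝ → ℝ} (hk : ContinuousOn (fun p : ℝ × ℝ => k p.1 p.2) (Ioi 0 ×ˢ univ))
    (hp : ∀ t > 0, ∀ x, k t (x + 2) = k t x) {ε T : ℝ} (hε : 0 < ε) :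
    ∃ C, ∀ t ∈ Icc ε T, ∀ x, |k t x| ≤ C := by
  obtain ⟨C, hC⟩ := ((isCompact_Icc (a := ε) (b := T)).prod
    (isCompact_Icc (a := (0:ℝ)) (b := 2))).exists_bound_of_continuousOn
    (hk.mono (fun p hp => ⟨lt_of_lt_of_le hε hp.1.1, mem_univ _⟩))
  refine ⟨C, fun t ht x => ?_⟩
  have hper : Function.Periodic (k t) 2 := fun x => hp t (lt_of_lt_of_le hε ht.1) x
  obtain ⟨y, hy, hxy⟩ := hper.exists_mem_Ico₀ (by norm_num) x
  rw [hxy]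
  exact hC (t, y) ⟨ht, Ico_subset_Icc_self hy⟩

section
variable {g gx : ℝ → ℝ → ℝ} {C : ℝ} {h : ℝ → ℝ} {C₀ : ℝ}
  (hg : Continuous (fun p : ℝ × ℝ => g p.1 p.2))
  (hb : ∀ s y, |g s y| ≤ C) (hh : Continuous h) (hhb : ∀ y, |h y| ≤ C₀)
  (hhp : ∀ x, h (x + 2) = h x) (hgp : ∀ s x, g s (x + 2) = g s x)
  (hgx : ContinuousOn (fun p : ℝ × ℝ => gx p.1 p.2) (Ioi 0 ×ˢ univ))
  (hgd : ∀ t > 0, ∀ y, HasDerivAt (g t) (gx t y) y)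
include hg hb hh hhb hhp hgp hgx hgd

lemma reg_local {ε T : ℝ} (hε : 0 < ε) (hT : ε < T) : ∃ V : ℝ → ℝ → ℝ,
    ContinuousOn (fun p : ℝ × ℝ => V p.1 p.2) (Ioi ε ×ˢ univ) ∧
    ∀ t ∈ Ioc ε T, ∀ x, HasDerivAt (MX h g t) (V t x) x := by
  set cl : ℝ → ℝ := fun s => max ε (min T (ε + s)) with hcl
  have hclc : Continuous cl := by fun_prop
  have hcl1 : ∀ s, cl s ∈ Icc ε T := fun s => ⟨le_max_left _ _, max_le hT.le (min_le_left _ _)⟩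
  have hcl0 : ∀ s, 0 < cl s := fun s => lt_of_lt_of_le hε (hcl1 s).1
  obtain ⟨C1, hC1⟩ := periodic_bound (T := T) hgx
    (fun t ht x => deriv_periodic (hgp t) (hgd t ht) x) hε
  obtain ⟨C2, hC2⟩ := periodic_bound (T := T) (MX_cont hg hb hh hhb)
    (fun t ht x => deriv_periodic (mild_periodic hhp hgp t) (mild_deriv_pos hg hb hh hhb ht) x) hε
  have c1 : Continuous (fun p : ℝ × ℝ => g (cl p.1) p.2) :=
    hg.comp (f := fun p : ℝ × ℝ => (cl p.1, p.2)) (by fun_prop)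
  have c2 : Continuous (fun p : ℝ × ℝ => gx (cl p.1) p.2) := by
    rw [← continuousOn_univ]
    exact hgx.comp (f := fun p : ℝ × ℝ => (cl p.1, p.2)) (by fun_prop)
      (fun p _ => ⟨hcl0 _, mem_univ _⟩)
  have c3 : Continuous (mild h g ε) :=
    (mild_cont hg hb hh hhb).comp (f := fun x => (ε, x)) (by fun_prop)
  have c4 : Continuous (MX h g ε) := by
    rw [← continuousOn_univ]
    exact (MX_cont hg hb hh hhb).comp (f := fun x => (ε, x)) (by fun_prop)
      (fun p _ => ⟨hε, mem_univ _⟩)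
  have b3 := mild_bound hg hb hh hhb ε
  have b4 : ∀ x, |MX h g ε x| ≤ C2 := hC2 ε ⟨le_rfl, hT.le⟩
  have A : ∀ t ∈ Icc ε T, mild h g t = mild (mild h g ε) (fun s => g (cl s)) (t - ε) := by
    intro t ht
    ext x
    have := mild_restart hg hb hh hhb hε.le (sub_nonneg.2 ht.1) x
    rw [add_sub_cancel] at this
    rw [this, mild, mild]
    congr 1
    refine intervalIntegral.integral_congr fun s hs => ?_
    rw [uIcc_of_le (sub_nonneg.2 ht.1)] at hs
    have : cl s = ε + s := by
      rw [hcl]; simp only []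
      rw [min_eq_right (by linarith [hs.2, ht.2]), max_eq_right (by linarith [hs.1])]
    simp only [this]
  have B : ∀ t ∈ Icc ε T, MX h g t = mild (MX h g ε) (fun s => gx (cl s)) (t - ε) := by
    intro t ht
    ext x
    have h1 := mild_deriv_pos hg hb hh hhb (lt_of_lt_of_le hε ht.1) x
    rw [A t ht] at h1
    exact h1.unique (mild_deriv c1 (fun s => hb (cl s)) c3 b3 (mild_deriv_pos hg hb hh hhb hε)
      c4 b4 c2 (fun s => hC1 _ (hcl1 s)) (fun s => hgd _ (hcl0 s)) (t - ε) x)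
  refine ⟨fun t x => MX (MX h g ε) (fun s => gx (cl s)) (t - ε) x, ?_, ?_⟩
  · exact (MX_cont c2 (fun s => hC1 _ (hcl1 s)) c4 b4).comp
      (f := fun p : ℝ × ℝ => (p.1 - ε, p.2)) (by fun_prop)
      (fun p hp => ⟨(sub_pos.2 hp.1 : 0 < p.1 - ε), mem_univ _⟩)
  · intro t ht x
    rw [B t ⟨ht.1.le, ht.2⟩]
    exact mild_deriv_pos c2 (fun s => hC1 _ (hcl1 s)) c4 b4 (sub_pos.2 ht.1) x

theorem reg : ∃ V : ℝ → ℝ → ℝ,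
    ContinuousOn (fun p : ℝ × ℝ => V p.1 p.2) (Ioi 0 ×ˢ univ) ∧
    (∀ t > 0, ∀ x, HasDerivAt (MX h g t) (V t x) x) ∧
    (∀ t > 0, ∀ x, HasDerivAt (fun s => mild h g s x) (V t x + g t x) t) := by
  have hV : ∀ t > 0, ∀ x, HasDerivAt (MX h g t) (deriv (MX h g t) x) x := by
    intro t ht x
    obtain ⟨V, -, hV⟩ := reg_local hg hb hh hhb hhp hgp hgx hgd (ε := t / 2) (T := t)
      (by linarith) (by linarith)
    exact (hV t ⟨by linarith, le_rfl⟩ x).differentiableAt.hasDerivAt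
  have hVc : ContinuousOn (fun p : ℝ × ℝ => deriv (MX h g p.1) p.2) (Ioi 0 ×ˢ univ) := by
    rintro ⟨t, x⟩ ⟨ht, -⟩
    have ht : 0 < t := ht
    obtain ⟨V, hVc, hV⟩ := reg_local hg hb hh hhb hhp hgp hgx hgd (ε := t / 2) (T := 2 * t)
      (by linarith) (by linarith)
    have o1 : Ioi (t / 2) ×ˢ (univ : Set ℝ) ∈ 𝓝 (t, x) :=
      prod_mem_nhds (Ioi_mem_nhds (by linarith)) univ_mem
    have o2 : Ioo (t / 2) (2 * t) ×ˢ (univ : Set ℝ) ∈ 𝓝 (t, x) :=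
      prod_mem_nhds (Ioo_mem_nhds (by linarith) (by linarith)) univ_mem
    refine ContinuousAt.continuousWithinAt ?_
    refine (hVc.continuousAt o1).congr ?_
    filter_upwards [o2] with p hp
    exact ((hV p.1 ⟨hp.1.1, hp.1.2.le⟩ p.2).deriv).symm
  refine ⟨fun t x => deriv (MX h g t) x, hVc, hV, fun t ht x => ?_⟩
  refine deriv_of_right (f := fun s => mild h g s x) (f' := fun t => deriv (MX h g t) x + g t x)
    ?_ ?_ ?_ ht
  · exact ((mild_cont hg hb hh hhb).comp (f := fun s => (s, x)) (by fun_prop)).continuousOn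
  · refine ContinuousOn.add ?_ (hg.comp (f := fun s => (s, x)) (by fun_prop)).continuousOn
    exact hVc.comp (f := fun s => (s, x)) (by fun_prop) (fun s hs => ⟨hs, mem_univ _⟩)
  · intro t ht
    have ht : 0 < t := ht
    have c3 : Continuous (mild h g t) :=
      (mild_cont hg hb hh hhb).comp (f := fun x => (t, x)) (by fun_prop)
    have c4 : Continuous (MX h g t) :=
      continuous_iff_continuousAt.2 fun x => (hV t ht x).continuousAt
    have c5 : Continuous (fun x => deriv (MX h g t) x) := by
      rw [← continuousOn_univ]
      exact hVc.comp (f := fun x => (t, x)) (by fun_prop) (fun p _ => ⟨ht, mem_univ _⟩)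
    have p1 : ∀ t > 0, ∀ x, MX h g t (x + 2) = MX h g t x := fun t ht x =>
      deriv_periodic (mild_periodic hhp hgp t) (mild_deriv_pos hg hb hh hhb ht) x
    obtain ⟨C2, hC2⟩ := periodic_bound (T := t) (MX_cont hg hb hh hhb) p1 ht
    obtain ⟨C3, hC3⟩ := periodic_bound (T := t) (k := fun t x => deriv (MX h g t) x) hVc
      (fun t ht x => deriv_periodic (p1 t ht) (hV t ht) x) ht
    have key := mild_right_deriv (g := fun s => g (t + s)) (C := C)
      (hg.comp (f := fun p : ℝ × ℝ => (t + p.1, p.2)) (by fun_prop)) (fun s => hb _)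
      c3 (mild_bound hg hb hh hhb t) (mild_deriv_pos hg hb hh hhb ht) c4
      (hC2 t ⟨le_rfl, le_rfl⟩) (hV t ht) c5 (hC3 t ⟨le_rfl, le_rfl⟩) x
    have key2 : HasDerivWithinAt (fun τ => mild h g (t + τ) x)
        (deriv (MX h g t) x + g (t + 0) x) (Ici 0) 0 := by
      refine key.congr (fun τ hτ => ?_) ?_
      · exact mild_restart hg hb hh hhb ht.le hτ x
      · exact mild_restart hg hb hh hhb ht.le le_rfl x
    have sh : HasDerivWithinAt (fun s : ℝ => s - t) 1 (Ioi t) t :=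
      ((hasDerivAt_id t).sub_const t).hasDerivWithinAt
    rw [add_zero] at key2
    have key3 : HasDerivWithinAt (fun τ => mild h g (t + τ) x)
        (deriv (MX h g t) x + g t x) (Ici 0) (t - t) := by rwa [sub_self]
    have := HasDerivWithinAt.comp (h := fun s => s - t) t key3 sh (fun s hs => by
      have : t < s := hs
      simp only [mem_Ici]; linarith)
    rw [mul_one] at this
    refine this.congr (fun s _ => ?_) ?_
    · simp
    · simp

end

end KPP

namespace KPP
open Filter Topology

lemma second_max {f f' : ℝ → ℝ} {f'' x₀ : ℝ} (hx₀ : x₀ ∈ Icc (0:ℝ) 1)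
    (hf : ∀ x ∈ Icc (0:ℝ) 1, HasDerivWithinAt f (f' x) (Icc 0 1) x)
    (hf2 : HasDerivWithinAt f' f'' (Icc 0 1) x₀) (h0 : f' 0 = 0) (h1 : f' 1 = 0)
    (hmax : ∀ x ∈ Icc (0:ℝ) 1, f x ≤ f x₀) : f'' ≤ 0 := by
  have hint : ∀ x ∈ Ioo (0:ℝ) 1, HasDerivAt f (f' x) x := fun x hx =>
    (hf x (Ioo_subset_Icc_self hx)).hasDerivAt (Icc_mem_nhds hx.1 hx.2)
  have hfc : ContinuousOn f (Icc 0 1) := fun x hx => (hf x hx).continuousWithinAt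
  have hz : f' x₀ = 0 := by
    rcases eq_or_lt_of_le hx₀.1 with h | h
    · rw [← h, h0]
    rcases eq_or_lt_of_le hx₀.2 with h' | h'
    · rw [h', h1]
    refine IsLocalMax.hasDerivAt_eq_zero ?_ (hint x₀ ⟨h, h'⟩)
    filter_upwards [Icc_mem_nhds h h'] with x hx using hmax x hx
  by_contra! hpos
  rw [hasDerivWithinAt_iff_tendsto_slope] at hf2
  have hev := hf2.eventually (lt_mem_nhds hpos)
  rw [eventually_nhdsWithin_iff, Metric.eventually_nhds_iff] at hev
  obtain ⟨δ, hδ, hev⟩ := hev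
  rcases eq_or_lt_of_le hx₀.2 with h' | h'
  · -- x₀ = 1
    subst h'
    set b := max 0 (1 - δ / 2) with hb
    have hb0 : 0 ≤ b := le_max_left _ _
    have hb1 : b < 1 := max_lt one_pos (by linarith)
    have hb2 : 1 - δ / 2 ≤ b := le_max_right _ _
    have : StrictAntiOn f (Icc b 1) := by
      refine strictAntiOn_of_deriv_neg (convex_Icc _ _) (hfc.mono (Icc_subset_Icc hb0 le_rfl)) ?_
      intro x hx
      rw [interior_Icc] at hx
      rw [(hint x ⟨by linarith [hx.1], hx.2⟩).deriv]
      have hs := hev (y := x) (by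
        rw [Real.dist_eq, abs_lt]; constructor <;> linarith [hx.1, hx.2])
        ⟨⟨by linarith [hx.1], hx.2.le⟩, ne_of_lt hx.2⟩
      rw [slope_def_field, h1, sub_zero] at hs
      by_contra! hc
      have := div_nonpos_of_nonneg_of_nonpos hc (by linarith [hx.2] : x - 1 ≤ 0)
      linarith
    have h3 := this (left_mem_Icc.2 hb1.le) (right_mem_Icc.2 hb1.le) hb1
    have h4 := hmax b ⟨hb0, hb1.le⟩
    linarith
  · set b := min 1 (x₀ + δ / 2) with hb
    have hb0 : b ≤ 1 := min_le_left _ _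
    have hb1 : x₀ < b := lt_min h' (by linarith)
    have hb2 : b ≤ x₀ + δ / 2 := min_le_right _ _
    have : StrictMonoOn f (Icc x₀ b) := by
      refine strictMonoOn_of_deriv_pos (convex_Icc _ _) (hfc.mono (Icc_subset_Icc hx₀.1 hb0)) ?_
      intro x hx
      rw [interior_Icc] at hx
      rw [(hint x ⟨by linarith [hx.1, hx₀.1], by linarith [hx.2]⟩).deriv]
      have hs := hev (y := x) (by
        rw [Real.dist_eq, abs_lt]; constructor <;> linarith [hx.1, hx.2])
        ⟨⟨by linarith [hx.1, hx₀.1], by linarith [hx.2]⟩, ne_of_gt hx.1⟩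
      rw [slope_def_field, hz, sub_zero] at hs
      by_contra! hc
      have := div_nonpos_of_nonpos_of_nonneg hc (by linarith [hx.1] : 0 ≤ x - x₀)
      linarith
    have h3 := this (left_mem_Icc.2 hb1.le) (right_mem_Icc.2 hb1.le) hb1
    have h4 := hmax b ⟨by linarith [hx₀.1], hb0⟩
    linarith

lemma deriv_nonneg_of_left_max {f : ℝ → ℝ} {f' t : ℝ} (ht : 0 < t) (hf : HasDerivAt f f' t)
    (hm : ∀ s ∈ Icc 0 t, f s ≤ f t) : 0 ≤ f' := by
  have h1 := (hasDerivWithinAt_iff_tendsto_slope' (s := Iio t) (by simp)).1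
    (hf.hasDerivWithinAt (s := Iio t))
  refine ge_of_tendsto h1 ?_
  have : Ioo 0 t ∈ 𝓝[<] t := Ioo_mem_nhdsLT ht
  filter_upwards [this] with s hs
  rw [slope_def_field]
  exact div_nonneg_of_nonpos (by linarith [hm s ⟨hs.1.le, hs.2.le⟩]) (by linarith [hs.2])

lemma maxprinc {w wt wx wxx : ℝ → ℝ → ℝ} {T K : ℝ}
    (hc : ContinuousOn (fun p : ℝ × ℝ => w p.1 p.2) (Icc 0 T ×ˢ Icc 0 1))
    (hdt : ∀ t ∈ Ioc 0 T, ∀ x ∈ Icc (0:ℝ) 1, HasDerivAt (fun s => w s x) (wt t x) t)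
    (hdx : ∀ t ∈ Ioc 0 T, ∀ x ∈ Icc (0:ℝ) 1, HasDerivWithinAt (w t) (wx t x) (Icc 0 1) x)
    (hdxx : ∀ t ∈ Ioc 0 T, ∀ x ∈ Icc (0:ℝ) 1, HasDerivWithinAt (wx t) (wxx t x) (Icc 0 1) x)
    (hN : ∀ t ∈ Ioc 0 T, wx t 0 = 0 ∧ wx t 1 = 0)
    (h0 : ∀ x ∈ Icc (0:ℝ) 1, w 0 x ≤ 0)
    (hineq : ∀ t ∈ Ioc 0 T, ∀ x ∈ Icc (0:ℝ) 1, 0 < w t x →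
      (∀ y ∈ Icc (0:ℝ) 1, w t y ≤ w t x) → wt t x ≤ wxx t x + K * w t x) :
    ∀ t ∈ Icc 0 T, ∀ x ∈ Icc (0:ℝ) 1, w t x ≤ 0 := by
  intro t ht x hx
  by_contra! hpos
  have hvc : ContinuousOn (fun p : ℝ × ℝ => exp (-(K + 1) * p.1) * w p.1 p.2)
      (Icc 0 T ×ˢ Icc 0 1) := ContinuousOn.mul (by fun_prop) hc
  obtain ⟨⟨t₀, x₀⟩, ⟨ht₀, hx₀⟩, hmax⟩ := (isCompact_Icc.prod isCompact_Icc).exists_isMaxOn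
    ⟨(t, x), ht, hx⟩ hvc
  have hmax' : ∀ s ∈ Icc 0 T, ∀ y ∈ Icc (0:ℝ) 1,
      exp (-(K + 1) * s) * w s y ≤ exp (-(K + 1) * t₀) * w t₀ x₀ :=
    fun s hs y hy => hmax (show (s, y) ∈ Icc 0 T ×ˢ Icc 0 1 from ⟨hs, hy⟩)
  simp only at ht₀ hx₀
  have hw0 : 0 < w t₀ x₀ := by
    have h1 := hmax' t ht x hx
    have h2 : 0 < exp (-(K + 1) * t) * w t x := mul_pos (exp_pos _) hpos
    exact (pos_iff_pos_of_mul_pos (lt_of_lt_of_le h2 h1)).1 (exp_pos _)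
  have ht0 : 0 < t₀ := by
    rcases eq_or_lt_of_le ht₀.1 with h | h
    · rw [← h] at hw0
      linarith [h0 x₀ hx₀]
    · exact h
  have hmem : t₀ ∈ Ioc 0 T := ⟨ht0, ht₀.2⟩
  have hmx : ∀ y ∈ Icc (0:ℝ) 1, w t₀ y ≤ w t₀ x₀ := fun y hy =>
    le_of_mul_le_mul_left (hmax' t₀ ht₀ y hy) (exp_pos _)
  have h2 := second_max hx₀ (hdx t₀ hmem) (hdxx t₀ hmem x₀ hx₀) (hN t₀ hmem).1 (hN t₀ hmem).2 hmx
  have h3 := hineq t₀ hmem x₀ hx₀ hw0 hmx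
  have hE : HasDerivAt (fun s : ℝ => exp (-(K + 1) * s)) (exp (-(K + 1) * t₀) * (-(K + 1))) t₀ := by
    simpa using ((hasDerivAt_id t₀).const_mul (-(K + 1))).exp
  have h4 := deriv_nonneg_of_left_max ht0 (hE.mul (hdt t₀ hmem x₀ hx₀))
    (fun s hs => hmax' s ⟨hs.1, hs.2.trans ht₀.2⟩ x₀ hx₀)
  have h5 : exp (-(K + 1) * t₀) * -(K + 1) * w t₀ x₀ + exp (-(K + 1) * t₀) * wt t₀ x₀
      = exp (-(K + 1) * t₀) * (wt t₀ x₀ - (K + 1) * w t₀ x₀) := by ring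
  rw [h5] at h4
  have h6 := nonneg_of_mul_nonneg_right h4 (exp_pos _)
  nlinarith

lemma rpow_lip {α B : ℝ} (hα : 1 ≤ α) {a b : ℝ} (ha : a ∈ Icc 0 B) (hb : b ∈ Icc 0 B) :
    |a ^ α - b ^ α| ≤ (α * B ^ (α - 1)) * |a - b| := by
  have := Convex.norm_image_sub_le_of_norm_hasDerivWithin_le (f := fun x : ℝ => x ^ α)
    (f' := fun x => α * x ^ (α - 1)) (s := Icc 0 B) (x := b) (y := a) (C := α * B ^ (α - 1))
    (fun x hx => (Real.hasDerivAt_rpow_const (Or.inr hα)).hasDerivWithinAt)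
    (fun x hx => by
      rw [Real.norm_eq_abs, abs_of_nonneg (mul_nonneg (by linarith) (Real.rpow_nonneg hx.1 _))]
      exact mul_le_mul_of_nonneg_left (Real.rpow_le_rpow hx.1 hx.2 (by linarith)) (by linarith))
    (convex_Icc _ _) hb ha
  simpa using this

lemma slice {u : ℝ → ℝ → ℝ} (hc : ContinuousOn (fun p : ℝ × ℝ => u p.1 p.2) (Ici 0 ×ˢ Icc 0 1))
    {t : ℝ} (ht : 0 ≤ t) : ContinuousOn (u t) (Icc 0 1) :=
  hc.comp (f := fun y => (t, y)) (by fun_prop) (fun y hy => ⟨ht, hy⟩)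

theorem uniq {α : ℝ} (hα : 1 ≤ α) {u₁ ut₁ ux₁ uxx₁ u₂ ut₂ ux₂ uxx₂ : ℝ → ℝ → ℝ}
    (h₁ : IsKPPSolution α u₁ ut₁ ux₁ uxx₁) (n₁ : KPPNonneg u₁)
    (h₂ : IsKPPSolution α u₂ ut₂ ux₂ uxx₂) (n₂ : KPPNonneg u₂)
    (h0 : ∀ x ∈ Icc (0:ℝ) 1, u₁ 0 x = u₂ 0 x) :
    ∀ t ∈ Ici (0:ℝ), ∀ x ∈ Icc (0:ℝ) 1, u₁ t x = u₂ t x := by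
  intro T hT x hx
  have hT : 0 ≤ T := hT
  obtain ⟨c1, -, -, -, dt1, dx1, dxx1, eq1, N1⟩ := h₁
  obtain ⟨c2, -, -, -, dt2, dx2, dxx2, eq2, N2⟩ := h₂
  have hsub : Icc 0 T ×ˢ Icc (0:ℝ) 1 ⊆ Ici 0 ×ˢ Icc 0 1 := prod_mono Icc_subset_Ici_self le_rfl
  obtain ⟨B1, hB1⟩ := (isCompact_Icc.prod isCompact_Icc).exists_bound_of_continuousOn (c1.mono hsub)
  obtain ⟨B2, hB2⟩ := (isCompact_Icc.prod isCompact_Icc).exists_bound_of_continuousOn (c2.mono hsub)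
  set B := max B1 B2 with hB
  have b1 : ∀ t ∈ Icc 0 T, ∀ y ∈ Icc (0:ℝ) 1, u₁ t y ∈ Icc 0 B := fun t ht y hy =>
    ⟨n₁ t ht.1 y hy, ((le_abs_self _).trans (hB1 (t, y) ⟨ht, hy⟩)).trans (le_max_left _ _)⟩
  have b2 : ∀ t ∈ Icc 0 T, ∀ y ∈ Icc (0:ℝ) 1, u₂ t y ∈ Icc 0 B := fun t ht y hy =>
    ⟨n₂ t ht.1 y hy, ((le_abs_self _).trans (hB2 (t, y) ⟨ht, hy⟩)).trans (le_max_right _ _)⟩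
  set K₀ : ℝ := α * B ^ (α - 1) * (1 + B) + B ^ α with hK₀
  have key := maxprinc (w := fun t y => (u₁ t y - u₂ t y) ^ 2)
    (wt := fun t y => 2 * (u₁ t y - u₂ t y) * (ut₁ t y - ut₂ t y))
    (wx := fun t y => 2 * (u₁ t y - u₂ t y) * (ux₁ t y - ux₂ t y))
    (wxx := fun t y => 2 * (ux₁ t y - ux₂ t y) ^ 2
      + 2 * (u₁ t y - u₂ t y) * (uxx₁ t y - uxx₂ t y)) (T := T) (K := 2 * K₀)
    (((c1.sub c2).pow 2).mono hsub)
    (fun t ht y hy => by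
      refine (((dt1 t ht.1 y hy).sub (dt2 t ht.1 y hy)).pow 2).congr_deriv ?_
      simp)
    (fun t ht y hy => by
      refine (((dx1 t ht.1 y hy).sub (dx2 t ht.1 y hy)).pow 2).congr_deriv ?_
      simp)
    (fun t ht y hy => by
      refine ((((dx1 t ht.1 y hy).sub (dx2 t ht.1 y hy)).const_mul 2).mul
        ((dxx1 t ht.1 y hy).sub (dxx2 t ht.1 y hy))).congr_deriv ?_
      simp; ring)
    (fun t ht => by
      simp [(N1 t ht.1).1, (N1 t ht.1).2, (N2 t ht.1).1, (N2 t ht.1).2])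
    (fun y hy => by simp [h0 y hy])
    (fun t ht y hy hpos hm => by
      have ht' : t ∈ Icc 0 T := ⟨ht.1.le, ht.2⟩
      have hm' : ∀ z ∈ Icc (0:ℝ) 1, |u₁ t z - u₂ t z| ≤ |u₁ t y - u₂ t y| := fun z hz =>
        sq_le_sq.1 (hm z hz)
      set d := |u₁ t y - u₂ t y| with hd
      have i1 : IntervalIntegrable (u₁ t) volume 0 1 :=
        (by rw [uIcc_of_le zero_le_one]; exact slice c1 ht.1.le :
          ContinuousOn (u₁ t) (uIcc 0 1)).intervalIntegrable
      have i2 : IntervalIntegrable (u₂ t) volume 0 1 :=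
        (by rw [uIcc_of_le zero_le_one]; exact slice c2 ht.1.le :
          ContinuousOn (u₂ t) (uIcc 0 1)).intervalIntegrable
      set m1 := ∫ y in (0:ℝ)..1, u₁ t y with hm1
      set m2 := ∫ y in (0:ℝ)..1, u₂ t y with hm2
      have e1 : |m1 - m2| ≤ d := by
        rw [hm1, hm2, ← intervalIntegral.integral_sub i1 i2]
        have := intervalIntegral.norm_integral_le_of_norm_le_const (a := 0) (b := 1) (C := d)
          (f := fun z => u₁ t z - u₂ t z) (fun z hz => by
            rw [uIoc_of_le zero_le_one] at hz
            exact hm' z (Ioc_subset_Icc_self hz))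
        simpa using this
      have e2 : |m1| ≤ B := by
        have := intervalIntegral.norm_integral_le_of_norm_le_const (a := 0) (b := 1) (C := B)
          (f := fun z => u₁ t z) (fun z hz => by
            rw [uIoc_of_le zero_le_one] at hz
            have := b1 t ht' z (Ioc_subset_Icc_self hz)
            rw [Real.norm_eq_abs, abs_of_nonneg this.1]; exact this.2)
        simpa using this
      have e3 := rpow_lip hα (b1 t ht' y hy) (b2 t ht' y hy)
      have e4 : |u₂ t y ^ α| ≤ B ^ α := by
        rw [abs_of_nonneg (Real.rpow_nonneg (b2 t ht' y hy).1 _)]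
        exact Real.rpow_le_rpow (b2 t ht' y hy).1 (b2 t ht' y hy).2 (by linarith)
      have hB0 : 0 ≤ B := (b1 t ht' y hy).1.trans (b1 t ht' y hy).2
      have e5 : |u₁ t y ^ α * (1 - m1) - u₂ t y ^ α * (1 - m2)| ≤ K₀ * d := by
        have : u₁ t y ^ α * (1 - m1) - u₂ t y ^ α * (1 - m2)
          = (u₁ t y ^ α - u₂ t y ^ α) * (1 - m1) + u₂ t y ^ α * (m2 - m1) := by ring
        rw [this]
        have f1 : |1 - m1| ≤ 1 + B := (abs_sub _ _).trans (by simpa using e2)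
        have f2 : |m2 - m1| ≤ d := by rwa [abs_sub_comm]
        calc _ ≤ |(u₁ t y ^ α - u₂ t y ^ α) * (1 - m1)| + |u₂ t y ^ α * (m2 - m1)| := abs_add_le _ _
          _ ≤ (α * B ^ (α - 1) * d) * (1 + B) + B ^ α * d := by
            rw [abs_mul, abs_mul]
            refine add_le_add (mul_le_mul e3 f1 (abs_nonneg _) ?_)
              (mul_le_mul e4 f2 (abs_nonneg _) (Real.rpow_nonneg hB0 _))
            exact (abs_nonneg _).trans e3
          _ = _ := by rw [hK₀]; ring
      rw [eq1 t ht.1 y hy, eq2 t ht.1 y hy]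
      have e6 : (u₁ t y - u₂ t y) * (u₁ t y ^ α * (1 - m1) - u₂ t y ^ α * (1 - m2))
          ≤ K₀ * (u₁ t y - u₂ t y) ^ 2 := by
        refine (le_abs_self _).trans ?_
        rw [abs_mul, ← sq_abs (u₁ t y - u₂ t y), ← hd]
        nlinarith [mul_le_mul_of_nonneg_left e5 (abs_nonneg (u₁ t y - u₂ t y))]
      nlinarith [sq_nonneg (ux₁ t y - ux₂ t y)])
    T ⟨hT, le_rfl⟩ x hx
  have : (u₁ T x - u₂ T x) ^ 2 = 0 := le_antisymm key (sq_nonneg _)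
  have := pow_eq_zero_iff (two_ne_zero) |>.1 this
  linarith

end KPP

namespace KPP
open ProbabilityTheory Filter Topology

lemma P_diff {f g : ℝ → ℝ} (hf : Continuous f) (hg : Continuous g) {C D : ℝ}
    (hfb : ∀ x, |f x| ≤ C) (hgb : ∀ x, |g x| ≤ C) (hd : ∀ x, |f x - g x| ≤ D) (a x : ℝ) :
    |P f a x - P g a x| ≤ D := by
  have i : ∀ k : ℝ → ℝ, Continuous k → (∀ x, |k x| ≤ C) →
      Integrable (fun z => k (x + a * z)) gam := fun k hk hkb =>
    Integrable.of_bound (C := C) (by fun_prop)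
      (Eventually.of_forall fun z => by rw [Real.norm_eq_abs]; exact hkb _)
  have : P f a x - P g a x = P (fun y => f y - g y) a x := by
    unfold P
    rw [← integral_sub (i f hf hfb) (i g hg hgb)]
  rw [this]
  exact P_bound hd a x

lemma Duh_diff {g₁ g₂ : ℝ → ℝ → ℝ} (h1 : Continuous (fun p : ℝ × ℝ => g₁ p.1 p.2))
    (h2 : Continuous (fun p : ℝ × ℝ => g₂ p.1 p.2)) {C D l : ℝ} (hl : 0 < l) (hD : 0 ≤ D)
    (hb1 : ∀ s y, |g₁ s y| ≤ C) (hb2 : ∀ s y, |g₂ s y| ≤ C)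
    (hd : ∀ s y, |g₁ s y - g₂ s y| ≤ D * exp (l * |s|)) {t : ℝ} (ht : 0 ≤ t) (x : ℝ) :
    |Duh g₁ t x - Duh g₂ t x| ≤ D / l * exp (l * t) := by
  unfold Duh
  have c : ∀ g : ℝ → ℝ → ℝ, Continuous (fun p : ℝ × ℝ => g p.1 p.2) → (∀ s y, |g s y| ≤ C) →
      IntervalIntegrable (fun s => P (g s) √(2 * (t - s)) x) volume 0 t := by
    intro g hg hb
    exact (P_cont hg hb (s := fun s : ℝ => s) (a := fun s : ℝ => √(2 * (t - s)))
      (x := fun _ => x) (by fun_prop) (by fun_prop) (by fun_prop)).intervalIntegrable _ _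
  rw [← intervalIntegral.integral_sub (c _ h1 hb1) (c _ h2 hb2)]
  have e : ∫ s in (0:ℝ)..t, D * exp (l * s) = D / l * exp (l * t) - D / l := by
    have := intervalIntegral.integral_eq_sub_of_hasDerivAt (a := 0) (b := t)
      (f := fun s => D / l * exp (l * s)) (f' := fun s => D * exp (l * s))
      (fun s _ => by
        refine ((((hasDerivAt_id s).const_mul l).exp).const_mul (D / l)).congr_deriv ?_
        simp; field_simp) (Continuous.intervalIntegrable (by fun_prop) _ _)
    rw [this]; simp
  have := intervalIntegral.norm_integral_le_of_norm_le (a := 0) (b := t) (μ := volume)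
    (f := fun s => P (g₁ s) √(2 * (t - s)) x - P (g₂ s) √(2 * (t - s)) x)
    (g := fun s => D * exp (l * s)) ht
    (Eventually.of_forall fun s hs => by
      rw [Real.norm_eq_abs]
      refine P_diff (C := C) ?_ ?_ (hb1 s) (hb2 s) (fun y => ?_) _ _
      · exact h1.comp (Continuous.prodMk_right s)
      · exact h2.comp (Continuous.prodMk_right s)
      · have := hd s y
        rwa [abs_of_pos hs.1] at this) (Continuous.intervalIntegrable (by fun_prop) _ _)
  rw [e] at this
  rw [Real.norm_eq_abs] at this
  have : 0 ≤ D / l := by positivity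
  linarith

theorem exists_mild {φ ψ fd h : ℝ → ℝ} {L B M C₀ : ℝ} (hL : 0 ≤ L) (hM : 0 < M)
    (hφL : ∀ r s, |φ r - φ s| ≤ L * |r - s|) (hφB : ∀ r, |φ r| ≤ B)
    (hψL : ∀ r s, |ψ r - ψ s| ≤ |r - s|) (hψB : ∀ r, |ψ r| ≤ M)
    (hfd : Continuous fd) (hh : Continuous h)
    (hhb : ∀ y, |h y| ≤ C₀) (hφc : Continuous φ) (hψc : Continuous ψ) :
    ∃ u : ℝ → ℝ → ℝ, Continuous (fun p : ℝ × ℝ => u p.1 p.2) ∧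
      ∀ t, 0 ≤ t → ∀ x,
        u t x = mild h (fun s y => φ (u s (fd y)) * ψ (∫ z in (0:ℝ)..1, u s z)) t x := by
  have hB : 0 ≤ B := (abs_nonneg _).trans (hφB 0)
  have hC₀ : 0 ≤ C₀ := (abs_nonneg _).trans (hhb 0)
  set D : ℝ := L * M + B + 1 with hD
  have hD0 : 0 < D := by positivity
  set l : ℝ := 2 * D with hl
  have hl0 : 0 < l := by positivity
  let X := BoundedContinuousFunction (ℝ × ℝ) ℝ
  let U : X → ℝ → ℝ → ℝ := fun v s y => exp (l * |s|) * v (s, y)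
  have hU : ∀ v : X, Continuous (fun p : ℝ × ℝ => U v p.1 p.2) := by
    intro v; have := v.continuous; fun_prop
  let m : X → ℝ → ℝ := fun v s => ∫ z in (0:ℝ)..1, U v s z
  have hm : ∀ v : X, Continuous (m v) := fun v =>
    intervalIntegral.continuous_parametric_intervalIntegral_of_continuous' (hU v) 0 1
  let G : X → ℝ → ℝ → ℝ := fun v s y => φ (U v s (fd y)) * ψ (m v s)
  have hG : ∀ v : X, Continuous (fun p : ℝ × ℝ => G v p.1 p.2) := by
    intro v
    have h1 : Continuous (fun p : ℝ × ℝ => U v p.1 (fd p.2)) :=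
      (hU v).comp (f := fun p : ℝ × ℝ => (p.1, fd p.2)) (by fun_prop)
    have h2 := hm v
    exact (hφc.comp h1).mul (hψc.comp (h2.comp continuous_fst))
  have hGb : ∀ (v : X) s y, |G v s y| ≤ B * M := by
    intro v s y
    rw [abs_mul]
    exact mul_le_mul (hφB _) (hψB _) (abs_nonneg _) hB
  have hUd : ∀ (v w : X) s y, |U v s y - U w s y| ≤ exp (l * |s|) * dist v w := by
    intro v w s y
    change |exp (l * |s|) * v (s, y) - exp (l * |s|) * w (s, y)| ≤ _
    rw [← mul_sub, abs_mul, abs_of_pos (exp_pos _)]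
    exact mul_le_mul_of_nonneg_left
      (by rw [← Real.dist_eq]; exact BoundedContinuousFunction.dist_coe_le_dist _) (exp_pos _).le
  have hmd : ∀ (v w : X) s, |m v s - m w s| ≤ exp (l * |s|) * dist v w := by
    intro v w s
    have ii : ∀ v : X, IntervalIntegrable (U v s) volume 0 1 := fun v =>
      ((hU v).comp (Continuous.prodMk_right s)).intervalIntegrable _ _
    change |(∫ z in (0:ℝ)..1, U v s z) - ∫ z in (0:ℝ)..1, U w s z| ≤ _
    rw [← intervalIntegral.integral_sub (ii v) (ii w)]
    have := intervalIntegral.norm_integral_le_of_norm_le_const (a := 0) (b := 1)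
      (f := fun z => U v s z - U w s z) (C := exp (l * |s|) * dist v w)
      (fun z _ => hUd v w s z)
    simpa using this
  have hGd : ∀ (v w : X) s y, |G v s y - G w s y| ≤ (D * dist v w) * exp (l * |s|) := by
    intro v w s y
    have e : G v s y - G w s y = (φ (U v s (fd y)) - φ (U w s (fd y))) * ψ (m v s)
        + φ (U w s (fd y)) * (ψ (m v s) - ψ (m w s)) := by
      change φ (U v s (fd y)) * ψ (m v s) - φ (U w s (fd y)) * ψ (m w s) = _
      ring
    have hE : 0 ≤ exp (l * |s|) * dist v w := by positivity
    have a1 : |(φ (U v s (fd y)) - φ (U w s (fd y))) * ψ (m v s)|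
        ≤ L * (exp (l * |s|) * dist v w) * M := by
      rw [abs_mul]
      exact mul_le_mul ((hφL _ _).trans (mul_le_mul_of_nonneg_left (hUd v w s _) hL)) (hψB _)
        (abs_nonneg _) (by positivity)
    have a2 : |φ (U w s (fd y)) * (ψ (m v s) - ψ (m w s))| ≤ B * (exp (l * |s|) * dist v w) := by
      rw [abs_mul]
      exact mul_le_mul (hφB _) ((hψL _ _).trans (hmd v w s)) (abs_nonneg _) hB
    rw [e]
    refine (abs_add_le _ _).trans ((add_le_add a1 a2).trans ?_)
    rw [hD]; nlinarith
  let Ψ : X → X := fun v => BoundedContinuousFunction.ofNormedAddCommGroup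
    (fun p : ℝ × ℝ => exp (-(l * |p.1|)) * mild h (G v) |p.1| p.2)
    (by
      have := (mild_cont (hG v) (hGb v) hh hhb).comp (f := fun p : ℝ × ℝ => (|p.1|, p.2))
        (by fun_prop)
      exact Continuous.mul (by fun_prop) this)
    (C₀ + B * M / l) (by
      intro p
      have h1 := mild_bound (hG v) (hGb v) hh hhb |p.1| p.2
      rw [abs_abs] at h1
      rw [norm_mul, Real.norm_eq_abs, Real.norm_eq_abs, abs_of_pos (exp_pos _)]
      have h2 := Real.add_one_le_exp (l * |p.1|)
      rw [Real.exp_neg, inv_mul_le_iff₀ (exp_pos _)]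
      refine h1.trans ?_
      have h3 : 1 ≤ exp (l * |p.1|) := Real.one_le_exp (by positivity)
      have h4 : B * M * |p.1| = B * M / l * (l * |p.1|) := by field_simp
      have h5 : 0 ≤ B * M / l := by positivity
      rw [h4]
      nlinarith)
  have hΨ : ContractingWith (1 / 2) Ψ := by
    refine ⟨by
      rw [← NNReal.coe_lt_coe]; push_cast; norm_num, LipschitzWith.of_dist_le_mul fun v w => ?_⟩
    rw [BoundedContinuousFunction.dist_le (by positivity)]
    intro p
    change dist (exp (-(l * |p.1|)) * mild h (G v) |p.1| p.2)
      (exp (-(l * |p.1|)) * mild h (G w) |p.1| p.2) ≤ _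
    rw [Real.dist_eq, ← mul_sub, abs_mul, abs_of_pos (exp_pos _), Real.exp_neg,
      inv_mul_le_iff₀ (exp_pos _)]
    have := Duh_diff (hG v) (hG w) hl0 (D := D * dist v w) (by positivity) (hGb v) (hGb w)
      (hGd v w) (abs_nonneg p.1) p.2
    have e : mild h (G v) |p.1| p.2 - mild h (G w) |p.1| p.2
      = Duh (G v) |p.1| p.2 - Duh (G w) |p.1| p.2 := by unfold mild; ring
    rw [e]
    refine this.trans (le_of_eq ?_)
    rw [hl]; push_cast; field_simp
  let v := ContractingWith.fixedPoint Ψ hΨ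
  have hv : Ψ v = v := hΨ.fixedPoint_isFixedPt
  refine ⟨U v, hU v, fun t ht x => ?_⟩
  have h1 : v (t, x) = exp (-(l * |t|)) * mild h (G v) |t| x := by
    conv_lhs => rw [← hv]
    rfl
  change exp (l * |t|) * v (t, x) = mild h (G v) t x
  rw [h1, ← mul_assoc, ← Real.exp_add, abs_of_nonneg ht]
  simp

end KPP

namespace KPP
open ProbabilityTheory Filter Topology

noncomputable def fold (x : ℝ) : ℝ := arccos (cos (π * x)) / π

lemma fold_cont : Continuous fold := by
  unfold fold
  exact (Real.continuous_arccos.comp (by fun_prop)).div_const _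

lemma fold_mem (x : ℝ) : fold x ∈ Icc (0:ℝ) 1 :=
  ⟨div_nonneg (arccos_nonneg _) pi_pos.le, (div_le_one pi_pos).2 (arccos_le_pi _)⟩

lemma fold_eq {x : ℝ} (hx : x ∈ Icc (0:ℝ) 1) : fold x = x := by
  unfold fold
  rw [Real.arccos_cos (mul_nonneg pi_pos.le hx.1) (by nlinarith [hx.2, pi_pos])]
  field_simp

lemma fold_neg (x : ℝ) : fold (-x) = fold x := by
  unfold fold
  rw [mul_neg, Real.cos_neg]

lemma fold_add (x : ℝ) : fold (x + 2) = fold x := by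
  unfold fold
  rw [show π * (x + 2) = π * x + 2 * π by ring, Real.cos_add_two_pi]

lemma even_fold {k : ℝ → ℝ} (he : ∀ x, k (-x) = k x) (hp : ∀ x, k (x + 2) = k x) (y : ℝ) :
    k (fold y) = k y := by
  have hP : Function.Periodic k 2 := hp
  have h1 : cos (π * fold y) = cos (π * y) := by
    unfold fold
    rw [mul_div_cancel₀ _ pi_pos.ne', Real.cos_arccos (neg_one_le_cos _) (cos_le_one _)]
  obtain ⟨n, hn | hn⟩ := Real.cos_eq_cos_iff.1 h1
  · have : y = fold y + n * 2 := by
      apply mul_left_cancel₀ pi_pos.ne'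
      rw [hn]; ring
    rw [this, hP.int_mul n, ← this]
  · have : y = -fold y + n * 2 := by
      apply mul_left_cancel₀ pi_pos.ne'
      rw [hn]; ring
    conv_rhs => rw [this, hP.int_mul n]
    rw [he]

theorem exists_phi {α M : ℝ} (hα : 1 ≤ α) (hM : 1 ≤ M) :
    ∃ (φ q : ℝ → ℝ) (L B : ℝ), 0 ≤ L ∧ (∀ r, HasDerivAt φ (q r) r) ∧ Continuous q ∧
      (∀ r s, |φ r - φ s| ≤ L * |r - s|) ∧ (∀ r, |φ r| ≤ B) ∧ φ 0 = 0 ∧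
      (∀ r, 0 ≤ r → 0 ≤ φ r) ∧ (∀ r ∈ Icc 0 M, φ r = r ^ α) := by
  have hM0 : 0 ≤ M := by linarith
  let cl : ℝ → ℝ := fun r => max 0 (min r M)
  have hcl : Continuous cl := by fun_prop
  have hcl0 : ∀ r, 0 ≤ cl r := fun r => le_max_left _ _
  have hclM : ∀ r, cl r ≤ M := fun r => max_le hM0 (min_le_right _ _)
  let q : ℝ → ℝ := fun r => α * cl r ^ (α - 1) * max 0 (1 - |r - cl r|)
  have hq : Continuous q := by
    have : Continuous (fun r => cl r ^ (α - 1)) := hcl.rpow_const fun r => Or.inr (by linarith)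
    fun_prop
  have hq0 : ∀ r, 0 ≤ q r := fun r =>
    mul_nonneg (mul_nonneg (by linarith) (rpow_nonneg (hcl0 r) _)) (le_max_left _ _)
  set L : ℝ := α * M ^ (α - 1) with hL
  have hL0 : 0 ≤ L := by positivity
  have hqL : ∀ r, q r ≤ L := by
    intro r
    have h1 : cl r ^ (α - 1) ≤ M ^ (α - 1) := rpow_le_rpow (hcl0 r) (hclM r) (by linarith)
    have h2 : max 0 (1 - |r - cl r|) ≤ 1 := max_le zero_le_one (by linarith [abs_nonneg (r - cl r)])
    calc q r ≤ α * cl r ^ (α - 1) * 1 :=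
          mul_le_mul_of_nonneg_left h2 (mul_nonneg (by linarith) (rpow_nonneg (hcl0 r) _))
      _ ≤ L := by rw [mul_one]; exact mul_le_mul_of_nonneg_left h1 (by linarith)
  have hsupp : HasCompactSupport q := by
    refine HasCompactSupport.intro (isCompact_Icc (a := -1) (b := M + 1)) fun r hr => ?_
    have : max 0 (1 - |r - cl r|) = 0 := by
      apply max_eq_left
      simp only [mem_Icc, not_and_or, not_le] at hr
      rcases hr with hr | hr
      · have : cl r = 0 := max_eq_left ((min_le_left _ _).trans (by linarith))
        rw [this, sub_zero, abs_of_neg (by linarith)]; linarith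
      · have : r - cl r ≥ 1 := by linarith [hclM r]
        linarith [le_abs_self (r - cl r)]
    change _ * _ = _
    rw [this, mul_zero]
  have hqi : Integrable q := hq.integrable_of_hasCompactSupport hsupp
  let φ : ℝ → ℝ := fun r => ∫ s in (0:ℝ)..r, q s
  have hd : ∀ r, HasDerivAt φ (q r) r := fun r =>
    intervalIntegral.integral_hasDerivAt_right (hq.intervalIntegrable _ _)
      hq.stronglyMeasurable.stronglyMeasurableAtFilter hq.continuousAt
  refine ⟨φ, q, L, ∫ r, ‖q r‖, hL0, hd, hq, ?_, ?_, by simp [φ], ?_, ?_⟩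
  · intro r s
    exact Convex.norm_image_sub_le_of_norm_hasDerivWithin_le (f := φ) (f' := q) (s := univ)
      (fun x _ => (hd x).hasDerivWithinAt)
      (fun x _ => by rw [Real.norm_eq_abs, abs_of_nonneg (hq0 x)]; exact hqL x)
      convex_univ (mem_univ _) (mem_univ _)
  · intro r
    refine (intervalIntegral.norm_integral_le_integral_norm_uIoc (f := q) (μ := volume)).trans ?_
    exact setIntegral_le_integral hqi.norm (Eventually.of_forall fun _ => norm_nonneg _)
  · intro r hr
    exact intervalIntegral.integral_nonneg hr fun s _ => hq0 s
  · intro r hr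
    have h1 : ∫ s in (0:ℝ)..r, q s = ∫ s in (0:ℝ)..r, α * s ^ (α - 1) := by
      apply intervalIntegral.integral_congr
      intro s hs
      rw [uIcc_of_le hr.1] at hs
      have : cl s = s := by
        change max 0 (min s M) = s
        rw [min_eq_left (hs.2.trans hr.2), max_eq_right hs.1]
      change α * cl s ^ (α - 1) * max 0 (1 - |s - cl s|) = _
      rw [this]; simp
    change ∫ s in (0:ℝ)..r, q s = _
    rw [h1, intervalIntegral.integral_const_mul, integral_rpow (Or.inl (by linarith))]
    have : α ≠ 0 := by linarith
    rw [sub_add_cancel, Real.zero_rpow this]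
    field_simp; ring

noncomputable def psi (M m : ℝ) : ℝ := 1 - max 1 (min m M)

lemma psi_cont (M : ℝ) : Continuous (psi M) := by unfold psi; fun_prop

lemma psi_nonpos (M m : ℝ) : psi M m ≤ 0 := by
  unfold psi; linarith [le_max_left 1 (min m M)]

lemma psi_bound {M : ℝ} (hM : 1 ≤ M) (m : ℝ) : |psi M m| ≤ M := by
  rw [abs_of_nonpos (psi_nonpos M m)]
  unfold psi
  linarith [max_le hM (min_le_right m M)]

lemma psi_lip (M r s : ℝ) : |psi M r - psi M s| ≤ |r - s| := by
  unfold psi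
  rw [show 1 - max 1 (min r M) - (1 - max 1 (min s M)) = max 1 (min s M) - max 1 (min r M) by ring]
  have h1 := abs_max_sub_max_le_max 1 (min s M) 1 (min r M)
  have h2 := abs_min_sub_min_le_max s M r M
  simp at h1 h2
  rw [abs_sub_comm r s]
  exact h1.trans h2

end KPP

namespace KPP
open ProbabilityTheory Filter Topology

lemma mass_ge {m J : ℝ → ℝ} {M : ℝ} (hM : 1 ≤ M) (hc : Continuous m) (h0 : 1 ≤ m 0)
    (hd : ∀ t > 0, HasDerivAt m (psi M (m t) * J t) t) : ∀ t, 0 ≤ t → 1 ≤ m t := by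
  intro T hT
  by_contra hlt
  push Not at hlt
  have hK : IsCompact (Icc 0 T ∩ m ⁻¹' Ici 1) :=
    isCompact_Icc.inter_right (isClosed_Ici.preimage hc)
  obtain ⟨s, ⟨hs, hs1⟩, hmax⟩ := hK.exists_isGreatest ⟨0, ⟨le_rfl, hT⟩, h0⟩
  have hs1 : 1 ≤ m s := hs1
  have hsT : s < T := lt_of_le_of_ne hs.2 (by rintro rfl; linarith)
  obtain ⟨c, hc1, hc2⟩ := exists_hasDerivAt_eq_slope m (fun t => psi M (m t) * J t) hsT
    hc.continuousOn (fun x hx => hd x (lt_of_le_of_lt hs.1 hx.1))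
  have hmc : m c < 1 := by
    by_contra hcc
    push Not at hcc
    have := hmax ⟨⟨hs.1.trans hc1.1.le, hc1.2.le⟩, hcc⟩
    linarith [hc1.1]
  have : psi M (m c) = 0 := by
    unfold psi
    rw [max_eq_left ((min_le_left _ _).trans hmc.le), sub_self]
  rw [this, zero_mul, eq_comm, div_eq_zero_iff] at hc2
  rcases hc2 with h | h <;> linarith

theorem exists_sol {α : ℝ} (hα : 1 ≤ α)
    {u₀ : ℝ → ℝ} (hu₀_cont : ContinuousOn u₀ (Icc 0 1))
    (hu₀_nonneg : ∀ x ∈ Icc (0:ℝ) 1, 0 ≤ u₀ x)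
    (hm₀ : 1 ≤ ∫ x in (0:ℝ)..1, u₀ x) :
    ∃ u ut ux uxx : ℝ → ℝ → ℝ, IsKPPSolution α u ut ux uxx ∧ KPPNonneg u ∧
        ∀ x ∈ Icc (0:ℝ) 1, u 0 x = u₀ x := by
  obtain ⟨C, hC⟩ := isCompact_Icc.exists_bound_of_continuousOn hu₀_cont
  set M := max 1 C with hMdef
  have hM : 1 ≤ M := le_max_left _ _
  have hCM : ∀ x ∈ Icc (0:ℝ) 1, |u₀ x| ≤ M := fun x hx => (hC x hx).trans (le_max_right _ _)
  obtain ⟨φ, q, L, B, hL, hφd, hq, hφL, hφB, hφ0, hφn, hφα⟩ := exists_phi hα hM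
  have hB : 0 ≤ B := (abs_nonneg _).trans (hφB 0)
  have hφc : Continuous φ := continuous_iff_continuousAt.2 fun r => (hφd r).continuousAt
  set h : ℝ → ℝ := fun x => u₀ (fold x) with hh_def
  have hh : Continuous h := hu₀_cont.comp_continuous fold_cont fold_mem
  have hhb : ∀ y, |h y| ≤ M := fun y => hCM _ (fold_mem y)
  have hhp : ∀ x, h (x + 2) = h x := fun x => by simp only [hh_def, fold_add]
  have hhe : ∀ x, h (-x) = h x := fun x => by simp only [hh_def, fold_neg]
  obtain ⟨u, hu, hmild⟩ := exists_mild (ψ := psi M) (fd := fold) hL (by linarith : 0 < M) hφL hφB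
    (psi_lip M) (psi_bound hM) fold_cont hh hhb hφc (psi_cont M)
  set m : ℝ → ℝ := fun s => ∫ z in (0:ℝ)..1, u s z with hm_def
  have hm : Continuous m :=
    intervalIntegral.continuous_parametric_intervalIntegral_of_continuous' hu 0 1
  set g : ℝ → ℝ → ℝ := fun s y => φ (u s (fold y)) * psi M (m s) with hg_def
  have hmild : ∀ t, 0 ≤ t → ∀ x, u t x = mild h g t x := hmild
  have hg : Continuous (fun p : ℝ × ℝ => g p.1 p.2) := by
    have h1 : Continuous (fun p : ℝ × ℝ => u p.1 (fold p.2)) :=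
      hu.comp (f := fun p : ℝ × ℝ => (p.1, fold p.2)) (by have := fold_cont; fun_prop)
    exact (hφc.comp h1).mul ((psi_cont M).comp (hm.comp continuous_fst))
  have hb : ∀ s y, |g s y| ≤ B * M := by
    intro s y
    rw [hg_def]; simp only
    rw [abs_mul]
    exact mul_le_mul (hφB _) (psi_bound hM _) (abs_nonneg _) hB
  have hgp : ∀ s x, g s (x + 2) = g s x := fun s x => by simp only [hg_def, fold_add]
  have hge : ∀ s x, g s (-x) = g s x := fun s x => by simp only [hg_def, fold_neg]
  have hup : ∀ t, 0 ≤ t → ∀ x, u t (x + 2) = u t x := fun t ht x => by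
    rw [hmild t ht, hmild t ht, mild_periodic hhp hgp]
  have hue : ∀ t, 0 ≤ t → ∀ x, u t (-x) = u t x := fun t ht x => by
    rw [hmild t ht, hmild t ht, mild_even hhe hge]
  have hgu : ∀ t, 0 ≤ t → ∀ y, g t y = φ (u t y) * psi M (m t) := fun t ht y => by
    simp only [hg_def]
    rw [even_fold (hue t ht) (hup t ht)]
  set ux := MX h g with hux_def
  have hux : ∀ t > 0, ∀ x, HasDerivAt (u t) (ux t x) x := fun t ht x => by
    have := mild_deriv_pos hg hb hh hhb ht x
    rwa [show mild h g t = u t from funext fun y => (hmild t ht.le y).symm] at this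
  have huxc : ContinuousOn (fun p : ℝ × ℝ => ux p.1 p.2) (Ioi 0 ×ˢ univ) := MX_cont hg hb hh hhb
  obtain ⟨V, hVc, hV, hVt⟩ := reg hg hb hh hhb hhp hgp
    (gx := fun t y => q (u t y) * ux t y * psi M (m t))
    (by
      have h1 : Continuous (fun p : ℝ × ℝ => q (u p.1 p.2)) := hq.comp hu
      have h2 : Continuous (fun p : ℝ × ℝ => psi M (m p.1)) :=
        (psi_cont M).comp (hm.comp continuous_fst)
      exact (h1.continuousOn.mul huxc).mul h2.continuousOn)
    (by
      intro t ht y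
      rw [show g t = fun y => φ (u t y) * psi M (m t) from funext (hgu t ht.le)]
      exact ((hφd (u t y)).comp y (hux t ht y)).mul_const _)
  have hut : ∀ t > 0, ∀ x, HasDerivAt (fun s => u s x) (V t x + g t x) t := fun t ht x => by
    refine (hVt t ht x).congr_of_eventuallyEq ?_
    filter_upwards [Ioi_mem_nhds ht] with s hs
    exact hmild s (le_of_lt hs) x
  have hu0 : ∀ x ∈ Icc (0:ℝ) 1, u 0 x = u₀ x := by
    intro x hx
    rw [hmild 0 le_rfl]
    unfold mild Duh
    simp [P_zero, hh_def, fold_eq hx]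
  have hN : ∀ t > 0, ux t 0 = 0 ∧ ux t 1 = 0 := by
    intro t ht
    constructor
    · have h1 := (hux t ht (-0)).scomp (0:ℝ) (hasDerivAt_neg (0:ℝ))
      have h2 : (u t ∘ fun x => -x) = u t := funext fun x => hue t ht.le x
      have h3 : HasDerivAt (u t) ((-1:ℝ) • ux t (-0)) 0 := by rw [← h2]; exact h1
      have := h3.unique (hux t ht 0)
      simp at this; linarith
    · have h0 : HasDerivAt (fun x : ℝ => 2 - x) (-1) 1 := by
        simpa using (hasDerivAt_id (1:ℝ)).const_sub 2
      have h1 := HasDerivAt.scomp_of_eq (1:ℝ) (hux t ht 1) h0 (by norm_num)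
      have h2 : (u t ∘ fun x => 2 - x) = u t := funext fun x => by
        simp only [Function.comp]
        rw [show (2 - x) = -x + 2 by ring, hup t ht.le, hue t ht.le]
      rw [h2] at h1
      have := h1.unique (hux t ht 1)
      simp at this; linarith
  have hutc : ContinuousOn (fun p : ℝ × ℝ => V p.1 p.2 + g p.1 p.2) (Ioi 0 ×ˢ univ) :=
    hVc.add hg.continuousOn
  -- nonnegativity
  have hnn : ∀ t, 0 ≤ t → ∀ x ∈ Icc (0:ℝ) 1, 0 ≤ u t x := by
    intro T hT x hx
    have := maxprinc (T := T) (K := L * M) (w := fun t x => - u t x)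
      (wt := fun t x => -(V t x + g t x)) (wx := fun t x => - ux t x) (wxx := fun t x => - V t x)
      hu.neg.continuousOn (fun t ht x _ => (hut t ht.1 x).neg)
      (fun t ht x _ => (hux t ht.1 x).neg.hasDerivWithinAt)
      (fun t ht x _ => (hV t ht.1 x).neg.hasDerivWithinAt)
      (fun t ht => by simp [hN t ht.1])
      (fun x hx => by simp only [hu0 x hx]; linarith [hu₀_nonneg x hx])
      (fun t ht x hx hpos _ => by
        have h1 : |g t x| ≤ L * M * (- u t x) := by
          rw [hgu t ht.1.le, abs_mul]
          have h2 := hφL (u t x) 0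
          rw [hφ0, sub_zero, sub_zero, abs_of_neg (by linarith : u t x < 0)] at h2
          calc _ ≤ (L * (- u t x)) * M := mul_le_mul h2 (psi_bound hM _) (abs_nonneg _)
                (mul_nonneg hL hpos.le)
            _ = _ := by ring
        linarith [neg_abs_le (g t x)]) T ⟨hT, le_rfl⟩ x hx
    linarith
  have hle : ∀ t, 0 ≤ t → ∀ x ∈ Icc (0:ℝ) 1, u t x ≤ M := by
    intro T hT x hx
    have := maxprinc (T := T) (K := 0) (w := fun t x => u t x - M)
      (wt := fun t x => (V t x + g t x)) (wx := fun t x => ux t x) (wxx := fun t x => V t x)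
      (by fun_prop) (fun t ht x _ => (hut t ht.1 x).sub_const _)
      (fun t ht x _ => ((hux t ht.1 x).sub_const _).hasDerivWithinAt)
      (fun t ht x _ => (hV t ht.1 x).hasDerivWithinAt)
      (fun t ht => hN t ht.1)
      (fun x hx => by simp only [hu0 x hx]; linarith [le_abs_self (u₀ x), hCM x hx])
      (fun t ht x hx hpos _ => by
        have h1 : g t x ≤ 0 := by
          rw [hgu t ht.1.le]
          exact mul_nonpos_of_nonneg_of_nonpos (hφn _ (hnn t ht.1.le x hx)) (psi_nonpos _ _)
        linarith) T ⟨hT, le_rfl⟩ x hx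
    linarith
  -- mass
  have hmd : ∀ t > 0, HasDerivAt m (psi M (m t) * ∫ y in (0:ℝ)..1, φ (u t y)) t := by
    intro t ht
    have hS : Icc (t / 2) (t + 1) ∈ 𝓝 t := Icc_mem_nhds (by linarith) (by linarith)
    have hsub : ∀ s ∈ Icc (t / 2) (t + 1), 0 < s := fun s hs => by linarith [hs.1]
    have h1 := param_deriv (k := fun s y => u s y) (k' := fun s y => V s y + g s y)
      (a := 0) (b := 1) hS isCompact_Icc hu.continuousOn
      (hutc.mono fun p hp => ⟨hsub _ hp.1, mem_univ _⟩)
      (fun s hs y _ => hut s (hsub s hs) y)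
    refine h1.congr_deriv ?_
    have hVi : Continuous (V t) := by
      rw [← continuousOn_univ]
      exact hVc.comp (f := fun y => (t, y)) (by fun_prop) (fun y _ => ⟨ht, mem_univ _⟩)
    have hgi : Continuous (g t) := hg.comp (Continuous.prodMk_right t)
    rw [intervalIntegral.integral_add (hVi.intervalIntegrable _ _) (hgi.intervalIntegrable _ _),
      intervalIntegral.integral_eq_sub_of_hasDerivAt (f := ux t) (fun x _ => hV t ht x)
        (hVi.intervalIntegrable _ _), (hN t ht).1, (hN t ht).2, sub_self, zero_add,
      ← intervalIntegral.integral_const_mul]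
    apply intervalIntegral.integral_congr
    intro y _
    simp only
    rw [hgu t ht.le, mul_comm]
  have hm0 : 1 ≤ m 0 := by
    refine hm₀.trans (le_of_eq ?_)
    apply intervalIntegral.integral_congr
    intro y hy
    rw [uIcc_of_le zero_le_one] at hy
    exact (hu0 y hy).symm
  have hm1 := mass_ge hM hm hm0 hmd
  have hmM : ∀ t, 0 ≤ t → m t ≤ M := by
    intro t ht
    have := intervalIntegral.integral_mono_on (a := 0) (b := 1) (μ := volume) (f := u t)
      (g := fun _ => M) zero_le_one
      ((hu.comp (Continuous.prodMk_right t)).intervalIntegrable _ _)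
      (by simp) (fun x hx => hle t ht x hx)
    simpa using this
  refine ⟨u, fun t x => V t x + g t x, ux, V, ⟨hu.continuousOn,
    hutc.mono (prod_mono le_rfl (subset_univ _)), huxc.mono (prod_mono le_rfl (subset_univ _)),
    hVc.mono (prod_mono le_rfl (subset_univ _)), fun t ht x _ => hut t ht x,
    fun t ht x _ => (hux t ht x).hasDerivWithinAt, fun t ht x _ => (hV t ht x).hasDerivWithinAt,
    fun t ht x hx => ?_, fun t ht => hN t ht⟩, fun t ht x hx => hnn t ht x hx, hu0⟩
  have ht' : (0:ℝ) ≤ t := le_of_lt ht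
  change V t x + g t x = V t x + u t x ^ α * (1 - m t)
  rw [hgu t ht', hφα _ ⟨hnn t ht' x hx, hle t ht' x hx⟩]
  unfold psi
  rw [min_eq_left (hmM t ht'), max_eq_right (hm1 t ht')]

end KPP

/-- **Global well-posedness, supercritical mass (`n = 1`).**  For `α ≥ 1` and a
continuous nonnegative initial datum `u₀` on `[0,1]` with `∫₀¹ u₀ ≥ 1`, the 1-D nonlocal
Fisher–KPP problem has a nonnegative classical solution with datum `u₀`, and any two
nonnegative classical solutions with datum `u₀` coincide on `[0,∞) × [0,1]`. -/
theorem global_wellposedness_supercritical (α : ℝ) (hα : 1 ≤ α)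
    (u₀ : ℝ → ℝ) (hu₀_cont : ContinuousOn u₀ (Icc 0 1))
    (hu₀_nonneg : ∀ x ∈ Icc (0:ℝ) 1, 0 ≤ u₀ x)
    (hm₀ : 1 ≤ ∫ x in (0:ℝ)..1, u₀ x) :
    (∃ u ut ux uxx : ℝ → ℝ → ℝ, IsKPPSolution α u ut ux uxx ∧ KPPNonneg u ∧
        ∀ x ∈ Icc (0:ℝ) 1, u 0 x = u₀ x) ∧
      ∀ u₁ ut₁ ux₁ uxx₁ u₂ ut₂ ux₂ uxx₂ : ℝ → ℝ → ℝ,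
        IsKPPSolution α u₁ ut₁ ux₁ uxx₁ → KPPNonneg u₁ →
        (∀ x ∈ Icc (0:ℝ) 1, u₁ 0 x = u₀ x) →
        IsKPPSolution α u₂ ut₂ ux₂ uxx₂ → KPPNonneg u₂ →
        (∀ x ∈ Icc (0:ℝ) 1, u₂ 0 x = u₀ x) →
        ∀ t ∈ Ici (0:ℝ), ∀ x ∈ Icc (0:ℝ) 1, u₁ t x = u₂ t x := by
  refine ⟨KPP.exists_sol hα hu₀_cont hu₀_nonneg hm₀, ?_⟩
  intro u₁ ut₁ ux₁ uxx₁ u₂ ut₂ ux₂ uxx₂ h₁ n₁ e₁ h₂ n₂ e₂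
  exact KPP.uniq hα h₁ n₁ h₂ n₂ (fun x hx => (e₁ x hx).trans (e₂ x hx).symm)
end

section
/- Let n ≥ 3 be an integer and let α, k, k' be real numbers with 1 ≤ α < 1 + 2/n, k > max{ (n−2)(α−1)/2, 1 }, k' > max{ n(α−1)/2, 1 }, and k' < k + α − 1. Define λ = ( kn/(2k') − kn/(2(k+α−1)) ) / ( kn/(2k') + 1 − n/2 ), θ = (k+α−1)(k'−1) / ( k'(k+α−2) ), η = (k+α−1)(k−1) / ( k(k+α−2) ), and r = (1−λ)·(2(k+α−1)/k) / ( 1 − λ(k+α−1)/k ). Then: (i) 0 < λ < 1; (ii) 2λ(k+α−1)/k < 2; (iii) λη + (1−λ)θ < 1; and (iv) k·r·θ/2 < k + α − 1. -/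
open Real

/-- **Exponent relations for the interpolation argument in dimension `n ≥ 3`.**
With `1 ≤ α < 1 + 2/n`, `k > max((n-2)(α-1)/2, 1)`, `k' > max(n(α-1)/2, 1)` and
`k' < k + α - 1`, the interpolation exponents `λ`, `θ`, `η`, `r` satisfy
`0 < λ < 1`, `2λ(k+α-1)/k < 2`, `λη + (1-λ)θ < 1` and `k·r·θ/2 < k + α - 1`. -/
theorem interpolation_exponents (n : ℕ) (hn : 3 ≤ n) (α k k' : ℝ)
    (hα1 : 1 ≤ α) (hα2 : α < 1 + 2 / (n : ℝ))
    (hk : max (((n : ℝ) - 2) * (α - 1) / 2) 1 < k)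
    (hk' : max ((n : ℝ) * (α - 1) / 2) 1 < k')
    (hkk' : k' < k + α - 1) :
    let lam : ℝ := (k * n / (2 * k') - k * n / (2 * (k + α - 1)))
      / (k * n / (2 * k') + 1 - n / 2)
    let θ : ℝ := (k + α - 1) * (k' - 1) / (k' * (k + α - 2))
    let η : ℝ := (k + α - 1) * (k - 1) / (k * (k + α - 2))
    let r : ℝ := (1 - lam) * (2 * (k + α - 1) / k) / (1 - lam * (k + α - 1) / k)
    0 < lam ∧ lam < 1 ∧
      2 * lam * (k + α - 1) / k < 2 ∧
      lam * η + (1 - lam) * θ < 1 ∧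
      k * r * θ / 2 < k + α - 1 := by
  intro lam θ η r
  obtain ⟨hk1, hk2⟩ := max_lt_iff.mp hk
  obtain ⟨hq1, hq2⟩ := max_lt_iff.mp hk'
  have hN : (3 : ℝ) ≤ (n : ℝ) := by exact_mod_cast hn
  generalize hNe : (n : ℝ) = N at *
  have hN0 : (0 : ℝ) < N := by linarith
  have hna : N * (α - 1) < 2 := by
    have h : α - 1 < 2 / N := by linarith
    rw [lt_div_iff₀ hN0] at h
    linarith
  obtain ⟨p, hp⟩ : ∃ p, p = k + α - 1 := ⟨_, rfl⟩
  have hp1 : k + α - 2 = p - 1 := by linarith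
  have hq0 : 0 < k' := by linarith
  have hk0 : 0 < k := by linarith
  have hp0 : 0 < p := by linarith
  have hpm : 0 < p - 1 := by linarith
  have hF : 0 < k * N - (N - 2) * p := by rw [hp]; nlinarith
  have hE : 0 < k * N - (N - 2) * k' := by nlinarith
  have hG : 0 < 2 * k' - N * (α - 1) := by linarith
  have hD : k * N / (2 * k') + 1 - N / 2 = (k * N - (N - 2) * k') / (2 * k') := by
    field_simp
    ring
  have hlam : lam = k * N * (p - k') / (p * (k * N - (N - 2) * k')) := by
    simp only [lam]
    rw [hNe, hD, ← hp]
    field_simp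
  have hlam1 : 1 - lam = k' * (k * N - (N - 2) * p) / (p * (k * N - (N - 2) * k')) := by
    rw [hlam, eq_div_iff (by positivity), sub_mul, div_mul_cancel₀ _ (by positivity)]
    ring
  have hlp : 1 - lam * p / k = (2 * k' - N * (α - 1)) / (k * N - (N - 2) * k') := by
    have h : lam * p / k = N * (p - k') / (k * N - (N - 2) * k') := by
      rw [hlam]
      field_simp
    rw [h, eq_div_iff hE.ne', sub_mul, div_mul_cancel₀ _ hE.ne', hp]
    ring
  have hpq : 0 < p - k' := by linarith
  have hl0 : 0 < lam := by rw [hlam]; positivity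
  have hl1 : 0 < 1 - lam := by rw [hlam1]; positivity
  have hlp0 : 0 < 1 - lam * p / k := by rw [hlp]; positivity
  have hθe : θ = p * (k' - 1) / (k' * (p - 1)) := by simp only [θ]; rw [← hp, hp1]
  have hηe : η = p * (k - 1) / (k * (p - 1)) := by simp only [η]; rw [← hp, hp1]
  have hθ : θ < 1 := by
    rw [hθe, div_lt_one (by positivity)]
    linarith
  have hη : η ≤ 1 := by
    rw [hηe, div_le_one (by positivity)]
    linarith
  have hr : k * r * θ / 2
      = p * ((k' - 1) * (k * N - (N - 2) * p) / ((2 * k' - N * (α - 1)) * (p - 1))) := by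
    simp only [r]
    rw [hθe, ← hp, hlp, hlam1]
    have hE' := hE.ne'
    have hG' := hG.ne'
    generalize k * N - (N - 2) * k' = E at hE' ⊢
    generalize 2 * k' - N * (α - 1) = G at hG' ⊢
    field_simp
  refine ⟨hl0, by linarith, ?_, by nlinarith, ?_⟩
  · rw [← hp]
    have : 2 * lam * p / k = 2 * (lam * p / k) := by ring
    linarith
  · rw [hr, ← hp]
    have h : (k' - 1) * (k * N - (N - 2) * p) / ((2 * k' - N * (α - 1)) * (p - 1)) < 1 := by
      rw [div_lt_one (by positivity)]
      have hk' : k = p - (α - 1) := by linarith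
      rw [hk']
      nlinarith [mul_pos hpq (sub_pos.mpr hna)]
    nlinarith
end
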